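/- arXiv:1112.0207 — 2 statements merged into one kernel-verified Lean document; each statement's English description precedes it below -/
import Mathlib

section
/- Let Ω be a strictly convex, open bounded domain in R² with connected C^∞ boundary (so the curvature κ(s) = −dθ/ds is negative along ∂Ω), symmetric under (x,y) ↦ (−x,−y), and let ω be a nontrivial solution of −Δω = μω in Ω, ∂ω/∂n = 0 on ∂Ω, ω = c ≠ 0 on ∂Ω, with Rω = −y ω_x + x ω_y. Then, using the tangent angle θ as variable along ∂Ω, the function g(θ) = (∂(Rω)/∂n)·(1/κ) satisfies ∫₀^{2π} g(θ) dθ = ∫₀^{2π} g(θ) cos kθ dθ = ∫₀^{2π} g(θ) sin kθ dθ = 0 for k = 1, 2, 3; consequently ∂(Rω)/∂n has at least 8 zeros along ∂Ω. -/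
noncomputable section
open Real MeasureTheory ComplexConjugate

/-- Partial derivative in the `x` direction. -/
def pdx (u : ℝ × ℝ → ℝ) (p : ℝ × ℝ) : ℝ := fderiv ℝ u p (1, 0)

/-- Partial derivative in the `y` direction. -/
def pdy (u : ℝ × ℝ → ℝ) (p : ℝ × ℝ) : ℝ := fderiv ℝ u p (0, 1)

/-- The Laplacian on `ℝ²`. -/
def lap (u : ℝ × ℝ → ℝ) (p : ℝ × ℝ) : ℝ := pdx (pdx u) p + pdy (pdy u) p

/-- Partial derivative in the `x` direction, for complex-valued functions. -/
def pdxC (u : ℝ × ℝ → ℂ) (p : ℝ × ℝ) : ℂ := fderiv ℝ u p (1, 0)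

/-- Partial derivative in the `y` direction, for complex-valued functions. -/
def pdyC (u : ℝ × ℝ → ℂ) (p : ℝ × ℝ) : ℂ := fderiv ℝ u p (0, 1)

/-- Normal derivative with respect to the outward unit normal
`n = (sin θ, -cos θ)`, where `θ` is the tangent angle at the boundary point. -/
def nderiv (th : ℝ) (u : ℝ × ℝ → ℝ) (p : ℝ × ℝ) : ℝ :=
  Real.sin th * pdx u p - Real.cos th * pdy u p

/-- Normal derivative for complex-valued functions. -/
def nderivC (th : ℝ) (u : ℝ × ℝ → ℂ) (p : ℝ × ℝ) : ℂ :=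
  (Real.sin th : ℂ) * pdxC u p - (Real.cos th : ℂ) * pdyC u p

/-- The rotation generator `R = -y ∂/∂x + x ∂/∂y`. -/
def Rop (u : ℝ × ℝ → ℝ) (p : ℝ × ℝ) : ℝ := -p.2 * pdx u p + p.1 * pdy u p

/-- The scaling generator `S = x ∂/∂x + y ∂/∂y`. -/
def Sop (u : ℝ × ℝ → ℝ) (p : ℝ × ℝ) : ℝ := p.1 * pdx u p + p.2 * pdy u p

/-- `Ω` is a (Euclidean) disk. -/
def IsDisk (Om : Set (ℝ × ℝ)) : Prop :=
  ∃ z : ℝ × ℝ, ∃ r : ℝ, 0 < r ∧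
    Om = {p : ℝ × ℝ | (p.1 - z.1) ^ 2 + (p.2 - z.2) ^ 2 < r ^ 2}

/-- `u` is `C^∞` on the closure of `Ω` (i.e. on an open neighborhood of it). -/
def SmoothNearClosure (Om : Set (ℝ × ℝ)) (u : ℝ × ℝ → ℝ) : Prop :=
  ∃ U : Set (ℝ × ℝ), IsOpen U ∧ closure Om ⊆ U ∧ ContDiffOn ℝ (⊤ : ℕ∞) u U

/-- Complexified gradient `∇u = u_x + i u_y`. -/
def gradC (u : ℝ × ℝ → ℝ) (p : ℝ × ℝ) : ℂ :=
  (pdx u p : ℂ) + Complex.I * (pdy u p : ℂ)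

/-- Complexified conjugate gradient `∇̄u = u_x - i u_y`. -/
def gradbarC (u : ℝ × ℝ → ℝ) (p : ℝ × ℝ) : ℂ :=
  (pdx u p : ℂ) - Complex.I * (pdy u p : ℂ)

/-- The bilinear form `B(φ, ψ; λ) = ∫∫_Ω (φ_x ψ̄_x + φ_y ψ̄_y - λ φ ψ̄)`. -/
def Bform (Om : Set (ℝ × ℝ)) (lam : ℝ) (phi psi : ℝ × ℝ → ℂ) : ℂ :=
  ∫ p in Om, (pdxC phi p * conj (pdxC psi p) + pdyC phi p * conj (pdyC psi p)
    - (lam : ℂ) * phi p * conj (psi p))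

section calculus

/-- Smoothness class used throughout. -/
abbrev Sm (u : ℝ × ℝ → ℝ) (U : Set (ℝ × ℝ)) : Prop := ContDiffOn ℝ (⊤ : ℕ∞) u U

lemma Sm.diffAt {u : ℝ × ℝ → ℝ} {U : Set (ℝ × ℝ)} (h : Sm u U) (hU : IsOpen U) {p : ℝ × ℝ}
    (hp : p ∈ U) : DifferentiableAt ℝ u p :=
  (h.differentiableOn (by simp)).differentiableAt (hU.mem_nhds hp)

lemma Sm.fd {u : ℝ × ℝ → ℝ} {U : Set (ℝ × ℝ)} (h : Sm u U) (hU : IsOpen U) :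
    ContDiffOn ℝ (⊤ : ℕ∞) (fderiv ℝ u) U :=
  h.fderiv_of_isOpen hU (by simp)

lemma Sm.pdx {u : ℝ × ℝ → ℝ} {U : Set (ℝ × ℝ)} (h : Sm u U) (hU : IsOpen U) : Sm (pdx u) U :=
  (h.fd hU).clm_apply contDiffOn_const

lemma Sm.pdy {u : ℝ × ℝ → ℝ} {U : Set (ℝ × ℝ)} (h : Sm u U) (hU : IsOpen U) : Sm (pdy u) U :=
  (h.fd hU).clm_apply contDiffOn_const

lemma Sm.comm {u : ℝ × ℝ → ℝ} {U : Set (ℝ × ℝ)} (h : Sm u U) (hU : IsOpen U) {p : ℝ × ℝ}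
    (hp : p ∈ U) : _root_.pdy (_root_.pdx u) p = _root_.pdx (_root_.pdy u) p := by
  have hs : IsSymmSndFDerivAt ℝ u p :=
    (h.contDiffAt (hU.mem_nhds hp)).isSymmSndFDerivAt
      (by rw [minSmoothness_of_isRCLikeNormedField]; exact WithTop.coe_le_coe.2 (le_top : (2 : ℕ∞) ≤ ⊤))
  have hd : DifferentiableAt ℝ (fderiv ℝ u) p :=
    ((h.fd hU).differentiableOn (by simp)).differentiableAt (hU.mem_nhds hp)
  have key : ∀ v w : ℝ × ℝ, fderiv ℝ (fun q => fderiv ℝ u q v) p w = fderiv ℝ (fderiv ℝ u) p w v := by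
    intro v w
    rw [fderiv_clm_apply hd (differentiableAt_const v)]
    simp
  unfold _root_.pdx _root_.pdy
  rw [key, key]
  exact hs _ _

lemma pdx_congr {u v : ℝ × ℝ → ℝ} {U : Set (ℝ × ℝ)} (hU : IsOpen U) (h : ∀ p ∈ U, u p = v p)
    {p : ℝ × ℝ} (hp : p ∈ U) : pdx u p = pdx v p := by
  unfold pdx
  rw [Filter.EventuallyEq.fderiv_eq]
  filter_upwards [hU.mem_nhds hp] with q hq using h q hq

lemma pdy_congr {u v : ℝ × ℝ → ℝ} {U : Set (ℝ × ℝ)} (hU : IsOpen U) (h : ∀ p ∈ U, u p = v p)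
    {p : ℝ × ℝ} (hp : p ∈ U) : pdy u p = pdy v p := by
  unfold pdy
  rw [Filter.EventuallyEq.fderiv_eq]
  filter_upwards [hU.mem_nhds hp] with q hq using h q hq

lemma pdx_add {u v : ℝ × ℝ → ℝ} {p : ℝ × ℝ} (hu : DifferentiableAt ℝ u p)
    (hv : DifferentiableAt ℝ v p) : pdx (fun q => u q + v q) p = pdx u p + pdx v p := by
  unfold pdx; rw [fderiv_fun_add hu hv]; rfl

lemma pdy_add {u v : ℝ × ℝ → ℝ} {p : ℝ × ℝ} (hu : DifferentiableAt ℝ u p)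
    (hv : DifferentiableAt ℝ v p) : pdy (fun q => u q + v q) p = pdy u p + pdy v p := by
  unfold pdy; rw [fderiv_fun_add hu hv]; rfl

lemma pdx_sub {u v : ℝ × ℝ → ℝ} {p : ℝ × ℝ} (hu : DifferentiableAt ℝ u p)
    (hv : DifferentiableAt ℝ v p) : pdx (fun q => u q - v q) p = pdx u p - pdx v p := by
  unfold pdx; rw [fderiv_fun_sub hu hv]; rfl

lemma pdy_sub {u v : ℝ × ℝ → ℝ} {p : ℝ × ℝ} (hu : DifferentiableAt ℝ u p)
    (hv : DifferentiableAt ℝ v p) : pdy (fun q => u q - v q) p = pdy u p - pdy v p := by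
  unfold pdy; rw [fderiv_fun_sub hu hv]; rfl

lemma pdx_mul {u v : ℝ × ℝ → ℝ} {p : ℝ × ℝ} (hu : DifferentiableAt ℝ u p)
    (hv : DifferentiableAt ℝ v p) :
    pdx (fun q => u q * v q) p = pdx u p * v p + u p * pdx v p := by
  unfold pdx; rw [fderiv_fun_mul hu hv]; simp; ring

lemma pdy_mul {u v : ℝ × ℝ → ℝ} {p : ℝ × ℝ} (hu : DifferentiableAt ℝ u p)
    (hv : DifferentiableAt ℝ v p) :
    pdy (fun q => u q * v q) p = pdy u p * v p + u p * pdy v p := by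
  unfold pdy; rw [fderiv_fun_mul hu hv]; simp; ring

lemma pdx_Rop {u : ℝ × ℝ → ℝ} {U : Set (ℝ × ℝ)} (h : Sm u U) (hU : IsOpen U) {p : ℝ × ℝ}
    (hp : p ∈ U) : pdx (Rop u) p = Rop (pdx u) p + pdy u p := by
  have hx := (h.pdx hU).diffAt hU hp
  have hy := (h.pdy hU).diffAt hU hp
  have e : Rop u = fun q => (fun q : ℝ × ℝ => -q.2) q * pdx u q + (fun q : ℝ × ℝ => q.1) q * pdy u q := rfl
  rw [e, pdx_add (by fun_prop) (by fun_prop), pdx_mul (by fun_prop) hx, pdx_mul (by fun_prop) hy]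
  have e1 : pdx (fun q : ℝ × ℝ => -q.2) p = 0 := by
    unfold pdx
    rw [((hasFDerivAt_snd (𝕜 := ℝ) (E := ℝ) (F := ℝ) (p := p)).fun_neg).fderiv]; simp
  have e2 : pdx (fun q : ℝ × ℝ => q.1) p = 1 := by
    unfold pdx
    rw [((hasFDerivAt_fst (𝕜 := ℝ) (E := ℝ) (F := ℝ) (p := p))).fderiv]; simp
  rw [e1, e2, Rop, ← h.comm hU hp]
  ring

lemma pdy_Rop {u : ℝ × ℝ → ℝ} {U : Set (ℝ × ℝ)} (h : Sm u U) (hU : IsOpen U) {p : ℝ × ℝ}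
    (hp : p ∈ U) : pdy (Rop u) p = Rop (pdy u) p - pdx u p := by
  have hx := (h.pdx hU).diffAt hU hp
  have hy := (h.pdy hU).diffAt hU hp
  have e : Rop u = fun q => (fun q : ℝ × ℝ => -q.2) q * pdx u q + (fun q : ℝ × ℝ => q.1) q * pdy u q := rfl
  rw [e, pdy_add (by fun_prop) (by fun_prop), pdy_mul (by fun_prop) hx, pdy_mul (by fun_prop) hy]
  have e1 : pdy (fun q : ℝ × ℝ => -q.2) p = -1 := by
    unfold pdy
    rw [((hasFDerivAt_snd (𝕜 := ℝ) (E := ℝ) (F := ℝ) (p := p)).fun_neg).fderiv]; simp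
  have e2 : pdy (fun q : ℝ × ℝ => q.1) p = 0 := by
    unfold pdy
    rw [((hasFDerivAt_fst (𝕜 := ℝ) (E := ℝ) (F := ℝ) (p := p))).fderiv]; simp
  rw [e1, e2, Rop, h.comm hU hp]
  ring

lemma Sm.Rop {u : ℝ × ℝ → ℝ} {U : Set (ℝ × ℝ)} (h : Sm u U) (hU : IsOpen U) : Sm (Rop u) U :=
  (contDiffOn_snd.neg.mul (h.pdx hU)).add (contDiffOn_fst.mul (h.pdy hU))

/-- Solutions of the Helmholtz equation on `U`. -/
def Helm (μ : ℝ) (u : ℝ × ℝ → ℝ) (U : Set (ℝ × ℝ)) : Prop := ∀ p ∈ U, lap u p = -μ * u p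

lemma Helm.pdx {μ : ℝ} {u : ℝ × ℝ → ℝ} {U : Set (ℝ × ℝ)} (hu : Helm μ u U) (h : Sm u U)
    (hU : IsOpen U) : Helm μ (pdx u) U := by
  intro p hp
  have h1 := pdx_congr hU (u := lap u) (v := fun q => (fun _ => -μ) q * u q) hu hp
  have e : lap u = fun q => _root_.pdx (_root_.pdx u) q + _root_.pdy (_root_.pdy u) q := rfl
  rw [pdx_mul (by fun_prop) (h.diffAt hU hp), e,
    pdx_add (((h.pdx hU).pdx hU).diffAt hU hp) (((h.pdy hU).pdy hU).diffAt hU hp)] at h1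
  have h2 : _root_.pdx (fun _ => -μ) p = 0 := by simp [_root_.pdx]
  rw [h2] at h1
  rw [lap, pdy_congr hU (fun q hq => h.comm hU hq) hp, (h.pdy hU).comm hU hp]
  linarith

lemma Helm.pdy {μ : ℝ} {u : ℝ × ℝ → ℝ} {U : Set (ℝ × ℝ)} (hu : Helm μ u U) (h : Sm u U)
    (hU : IsOpen U) : Helm μ (pdy u) U := by
  intro p hp
  have h1 := pdy_congr hU (u := lap u) (v := fun q => (fun _ => -μ) q * u q) hu hp
  have e : lap u = fun q => _root_.pdx (_root_.pdx u) q + _root_.pdy (_root_.pdy u) q := rfl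
  rw [pdy_mul (by fun_prop) (h.diffAt hU hp), e,
    pdy_add (((h.pdx hU).pdx hU).diffAt hU hp) (((h.pdy hU).pdy hU).diffAt hU hp)] at h1
  have h2 : _root_.pdy (fun _ => -μ) p = 0 := by simp [_root_.pdy]
  rw [h2] at h1
  rw [lap, pdx_congr hU (fun q hq => (h.comm hU hq).symm) hp, ← (h.pdx hU).comm hU hp]
  linarith

lemma Helm.sub {μ : ℝ} {u v : ℝ × ℝ → ℝ} {U : Set (ℝ × ℝ)} (hu : Helm μ u U) (hv : Helm μ v U)
    (h : Sm u U) (h' : Sm v U) (hU : IsOpen U) : Helm μ (fun q => u q - v q) U := by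
  intro p hp
  rw [lap, pdx_congr hU (fun q hq => pdx_sub (h.diffAt hU hq) (h'.diffAt hU hq)) hp,
    pdy_congr hU (fun q hq => pdy_sub (h.diffAt hU hq) (h'.diffAt hU hq)) hp,
    pdx_sub ((h.pdx hU).diffAt hU hp) ((h'.pdx hU).diffAt hU hp),
    pdy_sub ((h.pdy hU).diffAt hU hp) ((h'.pdy hU).diffAt hU hp)]
  have := hu p hp
  have := hv p hp
  unfold lap at *
  linarith

lemma Helm.Rop {μ : ℝ} {u : ℝ × ℝ → ℝ} {U : Set (ℝ × ℝ)} (hu : Helm μ u U)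
    (h : Sm u U) (hU : IsOpen U) : Helm μ (Rop u) U := by
  intro p hp
  have a1 := (hu.pdx h hU) p hp
  have a2 := (hu.pdy h hU) p hp
  rw [lap, pdx_congr hU (fun q hq => pdx_Rop h hU hq) hp,
    pdy_congr hU (fun q hq => pdy_Rop h hU hq) hp,
    pdx_add (((h.pdx hU).Rop hU).diffAt hU hp) ((h.pdy hU).diffAt hU hp),
    pdy_sub (((h.pdy hU).Rop hU).diffAt hU hp) ((h.pdx hU).diffAt hU hp),
    pdx_Rop (h.pdx hU) hU hp, pdy_Rop (h.pdy hU) hU hp]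
  unfold lap at a1 a2
  unfold _root_.Rop
  have c1 := h.comm hU hp
  have c2 := (h.pdx hU).comm hU hp
  have c3 := (h.pdy hU).comm hU hp
  have c4 : _root_.pdy (_root_.pdy (_root_.pdx u)) p = _root_.pdx (_root_.pdy (_root_.pdy u)) p := by
    rw [pdy_congr hU (fun q hq => h.comm hU hq) hp, c3]
  have c5 : _root_.pdy (_root_.pdx (_root_.pdx u)) p = _root_.pdx (_root_.pdx (_root_.pdy u)) p := by
    rw [c2, pdx_congr hU (fun q hq => h.comm hU hq) hp]
  rw [c4] at a1
  linear_combination (-p.2) * a1 + p.1 * a2 + p.1 * c5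

lemma Sm.grad_chain {u : ℝ × ℝ → ℝ} {U : Set (ℝ × ℝ)} (h : Sm u U) (hU : IsOpen U)
    {γ : ℝ → ℝ × ℝ} {s a b : ℝ} (hγ : HasDerivAt γ (a, b) s) (hp : γ s ∈ U) :
    HasDerivAt (fun s => u (γ s)) (a * _root_.pdx u (γ s) + b * _root_.pdy u (γ s)) s := by
  have := (h.diffAt hU hp).hasFDerivAt.comp_hasDerivAt s hγ
  convert! this using 1
  have e : ((a, b) : ℝ × ℝ) = a • (1, 0) + b • (0, 1) := by simp
  rw [e, map_add, map_smul, map_smul]; rfl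

end calculus

section green

lemma closed_form_integral {Om U : Set (ℝ × ℝ)} (hopen : IsOpen Om) (hconv : Convex ℝ Om)
    (h0 : (0 : ℝ × ℝ) ∈ Om) (hU : IsOpen U) (hOU : closure Om ⊆ U) {P Q : ℝ × ℝ → ℝ}
    (hP : Sm P U) (hQ : Sm Q U) (hdiv : ∀ p ∈ Om, pdx P p + pdy Q p = 0)
    {γ : ℝ → ℝ × ℝ} {θ : ℝ → ℝ} {L : ℝ} (hθ : Continuous θ)
    (hγ : ∀ s, HasDerivAt γ (Real.cos (θ s), Real.sin (θ s)) s) (hper : γ L = γ 0)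
    (hcl : ∀ s, γ s ∈ closure Om) :
    ∫ s in (0 : ℝ)..L, (P (γ s) * Real.sin (θ s) - Q (γ s) * Real.cos (θ s)) = 0 := by
  have hγc : Continuous γ := continuous_iff_continuousAt.2 fun s => (hγ s).continuousAt
  have hOmU : Om ⊆ U := subset_closure.trans hOU
  -- the potential
  let η : ℝ × ℝ → (ℝ × ℝ →L[ℝ] ℝ) := fun p =>
    P p • ContinuousLinearMap.snd ℝ ℝ ℝ - Q p • ContinuousLinearMap.fst ℝ ℝ ℝ
  have hηd : ∀ p ∈ Om, HasFDerivAt η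
      ((fderiv ℝ P p).smulRight (ContinuousLinearMap.snd ℝ ℝ ℝ)
        - (fderiv ℝ Q p).smulRight (ContinuousLinearMap.fst ℝ ℝ ℝ)) p := by
    intro p hp
    exact ((hP.diffAt hU (hOmU hp)).hasFDerivAt.smul_const (ContinuousLinearMap.snd ℝ ℝ ℝ)).sub
      ((hQ.diffAt hU (hOmU hp)).hasFDerivAt.smul_const (ContinuousLinearMap.fst ℝ ℝ ℝ))
  obtain ⟨F, hF⟩ := hconv.exists_forall_hasFDerivAt_of_fderiv_symmetric (ω := η) hopen
    (fun p hp => (hηd p hp).differentiableAt.differentiableWithinAt) (by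
      intro p hp x y
      rw [(hηd p hp).fderiv]
      have e : ∀ (T : ℝ × ℝ →L[ℝ] ℝ) (z : ℝ × ℝ), T z = z.1 * T (1, 0) + z.2 * T (0, 1) := by
        intro T z
        have : z = z.1 • ((1, 0) : ℝ × ℝ) + z.2 • ((0, 1) : ℝ × ℝ) := by simp
        conv_lhs => rw [this, map_add, map_smul, map_smul]
        rfl
      have h := hdiv p hp
      unfold pdx pdy at h
      simp only [sub_apply, ContinuousLinearMap.smulRight_apply,
        smul_apply, ContinuousLinearMap.coe_snd', ContinuousLinearMap.coe_fst',
        smul_eq_mul]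
      rw [e (fderiv ℝ P p) x, e (fderiv ℝ P p) y, e (fderiv ℝ Q p) x, e (fderiv ℝ Q p) y]
      linear_combination (x.1 * y.2 - x.2 * y.1) * h)
  have hmem : ∀ t ∈ Set.Ico (0 : ℝ) 1, ∀ s, t • γ s ∈ Om := by
    intro t ht s
    have := hconv.combo_interior_closure_mem_interior (x := 0) (y := γ s)
      (by rwa [hopen.interior_eq]) (hcl s) (a := 1 - t) (b := t) (by linarith [ht.2]) ht.1 (by ring)
    rwa [hopen.interior_eq, smul_zero, zero_add] at this
  have hmem' : ∀ t ∈ Set.Icc (0 : ℝ) 1, ∀ s, t • γ s ∈ U := by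
    intro t ht s
    rcases eq_or_lt_of_le ht.2 with h | h
    · rw [h, one_smul]; exact hOU (hcl s)
    · exact hOmU (hmem t ⟨ht.1, h⟩ s)
  -- clamped parametrized integral
  let c : ℝ → ℝ := fun t => (Set.projIcc (0 : ℝ) 1 zero_le_one t : ℝ)
  have hcc : Continuous c := continuous_subtype_val.comp continuous_projIcc
  have hcU : ∀ x : ℝ × ℝ, c x.1 • γ x.2 ∈ U := fun x => hmem' _ (Set.projIcc (0:ℝ) 1 zero_le_one x.1).2 _
  have hcγ : Continuous fun x : ℝ × ℝ => c x.1 • γ x.2 := by fun_prop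
  have hPc : Continuous fun x : ℝ × ℝ => P (c x.1 • γ x.2) :=
    hP.continuousOn.comp_continuous hcγ hcU
  have hQc : Continuous fun x : ℝ × ℝ => Q (c x.1 • γ x.2) :=
    hQ.continuousOn.comp_continuous hcγ hcU
  let J : ℝ → ℝ := fun t => ∫ s in (0 : ℝ)..L,
    (P (c t • γ s) * Real.sin (θ s) - Q (c t • γ s) * Real.cos (θ s))
  have hJc : Continuous J := by
    apply intervalIntegral.continuous_parametric_intervalIntegral_of_continuous'
    have h1 : Continuous fun x : ℝ × ℝ => Real.sin (θ x.2) := by fun_prop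
    have h2 : Continuous fun x : ℝ × ℝ => Real.cos (θ x.2) := by fun_prop
    exact (hPc.mul h1).sub (hQc.mul h2)
  have hJ0 : ∀ t ∈ Set.Ioo (0 : ℝ) 1, J t = 0 := by
    intro t ht
    have hct : c t = t := by
      simp only [c]; rw [Set.projIcc_of_mem zero_le_one ⟨ht.1.le, ht.2.le⟩]
    have hd : ∀ s, HasDerivAt (fun s => F (t • γ s))
        (t * (P (c t • γ s) * Real.sin (θ s) - Q (c t • γ s) * Real.cos (θ s))) s := by
      intro s
      have := (hF _ (hmem t ⟨ht.1.le, ht.2⟩ s)).comp_hasDerivAt s ((hγ s).const_smul t)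
      convert! this using 1
      rw [hct]
      simp [η]
      ring
    have hcont : Continuous fun s =>
        (t * (P (c t • γ s) * Real.sin (θ s) - Q (c t • γ s) * Real.cos (θ s))) := by
      have a1 : Continuous fun s => P (c t • γ s) :=
        hPc.comp (by fun_prop : Continuous fun s : ℝ => (t, s))
      have a2 : Continuous fun s => Q (c t • γ s) :=
        hQc.comp (by fun_prop : Continuous fun s : ℝ => (t, s))
      have a3 : Continuous fun s => Real.sin (θ s) := by fun_prop
      have a4 : Continuous fun s => Real.cos (θ s) := by fun_prop
      exact continuous_const.mul ((a1.mul a3).sub (a2.mul a4))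
    have := intervalIntegral.integral_eq_sub_of_hasDerivAt (fun s _ => hd s)
      (hcont.intervalIntegrable 0 L)
    rw [hper, sub_self, intervalIntegral.integral_const_mul] at this
    rcases mul_eq_zero.1 this with h | h
    · exact absurd h ht.1.ne'
    · exact h
  have hJ1 : J 1 = 0 := by
    have hcl1 : (1 : ℝ) ∈ closure (Set.Ioo (0 : ℝ) 1) := by
      rw [closure_Ioo zero_ne_one]; simp
    have : closure (Set.Ioo (0 : ℝ) 1) ⊆ {t | J t = 0} :=
      closure_minimal hJ0 (isClosed_eq hJc continuous_const)
    exact this hcl1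
  have hc1 : c 1 = 1 := by simp [c]
  simpa only [J, hc1, one_smul] using hJ1

lemma green_helm {Om U : Set (ℝ × ℝ)} (hopen : IsOpen Om) (hconv : Convex ℝ Om)
    (h0 : (0 : ℝ × ℝ) ∈ Om) (hU : IsOpen U) (hOU : closure Om ⊆ U) {u v : ℝ × ℝ → ℝ} {μ : ℝ}
    (hu : Sm u U) (hv : Sm v U) (hu' : Helm μ u Om) (hv' : Helm μ v Om)
    {γ : ℝ → ℝ × ℝ} {θ : ℝ → ℝ} {L : ℝ} (hθ : Continuous θ)
    (hγ : ∀ s, HasDerivAt γ (Real.cos (θ s), Real.sin (θ s)) s) (hper : γ L = γ 0)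
    (hcl : ∀ s, γ s ∈ closure Om) (hzero : ∀ s, u (γ s) = 0) :
    ∫ s in (0 : ℝ)..L, nderiv (θ s) u (γ s) * v (γ s) = 0 := by
  have hOmU : Om ⊆ U := subset_closure.trans hOU
  have hux := hu.pdx hU
  have huy := hu.pdy hU
  have hvx := hv.pdx hU
  have hvy := hv.pdy hU
  have := closed_form_integral hopen hconv h0 hU hOU
    (P := fun q => v q * pdx u q - u q * pdx v q) (Q := fun q => v q * pdy u q - u q * pdy v q)
    ((hv.mul hux).sub (hu.mul hvx)) ((hv.mul huy).sub (hu.mul hvy)) (by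
      intro p hp'
      have hp := hOmU hp'
      have du := hu.diffAt hU hp
      have dv := hv.diffAt hU hp
      have dux := hux.diffAt hU hp
      have duy := huy.diffAt hU hp
      have dvx := hvx.diffAt hU hp
      have dvy := hvy.diffAt hU hp
      rw [pdx_sub (by fun_prop) (by fun_prop), pdy_sub (by fun_prop) (by fun_prop),
        pdx_mul dv dux, pdx_mul du dvx, pdy_mul dv duy, pdy_mul du dvy]
      have a := hu' p hp'
      have b := hv' p hp'
      unfold lap at a b
      linear_combination v p * a - u p * b) hθ hγ hper hcl
  rw [← this]
  congr 1
  ext s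
  rw [hzero, nderiv]
  ring

end green

section symmetry

lemma theta_int {θ : ℝ → ℝ} {L : ℝ} (hL : 0 < L) (hθper : ∀ s, θ (s + L) = θ s + 2 * π) (s : ℝ)
    (k : ℤ) : θ (s + k * L) = θ s + k * (2 * π) := by
  have hp : Function.Periodic (fun s => θ s - 2 * π / L * s) L := by
    intro s
    simp only [hθper]
    field_simp
    ring
  have : θ (s + k * L) - 2 * π / L * (s + k * L) = θ s - 2 * π / L * s := hp.int_mul k s
  have e : 2 * π / L * (s + k * L) = 2 * π / L * s + k * (2 * π) := by field_simp
  rw [e] at this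
  linarith

lemma support_point {γ : ℝ → ℝ × ℝ} {θ : ℝ → ℝ} {L : ℝ} (hL : 0 < L)
    (hθmono : StrictMono θ) (hθc : Continuous θ)
    (hγ : ∀ s, HasDerivAt γ (Real.cos (θ s), Real.sin (θ s)) s)
    (hγper : ∀ s, γ (s + L) = γ s) (hθper : ∀ s, θ (s + L) = θ s + 2 * π) (s₀ s₁ : ℝ)
    (hmax : ∀ s, Real.sin (θ s₀) * (γ s).1 - Real.cos (θ s₀) * (γ s).2
      ≤ Real.sin (θ s₀) * (γ s₁).1 - Real.cos (θ s₀) * (γ s₁).2) : γ s₁ = γ s₀ := by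
  let f : ℝ → ℝ := fun s => Real.sin (θ s₀) * (γ s).1 - Real.cos (θ s₀) * (γ s).2
  have hf : ∀ s, HasDerivAt f (Real.sin (θ s₀ - θ s)) s := by
    intro s
    have h1 : HasDerivAt (fun s => (γ s).1) (Real.cos (θ s)) s :=
      (hasFDerivAt_fst (𝕜 := ℝ) (p := γ s)).comp_hasDerivAt s (hγ s)
    have h2 : HasDerivAt (fun s => (γ s).2) (Real.sin (θ s)) s :=
      (hasFDerivAt_snd (𝕜 := ℝ) (p := γ s)).comp_hasDerivAt s (hγ s)
    rw [Real.sin_sub]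
    exact (h1.const_mul _).sub (h2.const_mul _)
  have hloc : IsLocalMax f s₁ := Filter.Eventually.of_forall hmax
  have h0 := hloc.hasDerivAt_eq_zero (hf s₁)
  obtain ⟨n, hn⟩ := Real.sin_eq_zero_iff.1 h0
  rcases Int.even_or_odd' n with ⟨k, hk | hk⟩
  · have e : s₀ = s₁ + k * L := by
      apply hθmono.injective
      rw [theta_int hL hθper]
      rw [hk] at hn
      push_cast at hn
      linarith
    have hp : Function.Periodic γ L := hγper
    rw [e, hp.int_mul k s₁]
  · exfalso
    obtain ⟨s₂, hs₂, e⟩ := intermediate_value_Icc (by linarith : s₁ ≤ s₁ + L) hθc.continuousOn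
      (show θ s₁ + π ∈ Set.Icc (θ s₁) (θ (s₁ + L)) by
        rw [hθper]; constructor <;> linarith [Real.pi_pos])
    have h12 : s₁ < s₂ := hθmono.lt_iff_lt.1 (by linarith [Real.pi_pos])
    have hm : StrictMonoOn f (Set.Icc s₁ s₂) := by
      apply strictMonoOn_of_deriv_pos (convex_Icc _ _)
        (fun s _ => (hf s).continuousAt.continuousWithinAt)
      intro s hs
      rw [interior_Icc] at hs
      rw [(hf s).deriv]
      have e1 : θ s₀ - θ s = (π - (θ s - θ s₁)) + k * (2 * π) := by
        rw [hk] at hn; push_cast at hn; linarith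
      rw [e1, Real.sin_add_int_mul_two_pi, Real.sin_pi_sub]
      apply Real.sin_pos_of_pos_of_lt_pi
      · linarith [hθmono hs.1]
      · linarith [hθmono hs.2]
    have := hm (Set.left_mem_Icc.2 h12.le) (Set.right_mem_Icc.2 h12.le) h12
    exact absurd (hmax s₂) (not_le.2 this)

lemma support_max {Om : Set (ℝ × ℝ)} (hopen : IsOpen Om) (hne : Om.Nonempty)
    (hbdd : Bornology.IsBounded Om)
    {γ : ℝ → ℝ × ℝ} {θ : ℝ → ℝ} {L : ℝ} (hL : 0 < L)
    (hθmono : StrictMono θ) (hθc : Continuous θ)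
    (hγ : ∀ s, HasDerivAt γ (Real.cos (θ s), Real.sin (θ s)) s)
    (hγper : ∀ s, γ (s + L) = γ s) (hθper : ∀ s, θ (s + L) = θ s + 2 * π)
    (hrange : Set.range γ = frontier Om) (s₀ : ℝ) :
    ∀ q ∈ closure Om, Real.sin (θ s₀) * q.1 - Real.cos (θ s₀) * q.2
      ≤ Real.sin (θ s₀) * (γ s₀).1 - Real.cos (θ s₀) * (γ s₀).2 := by
  have hcomp : IsCompact (closure Om) := hbdd.isCompact_closure
  obtain ⟨p, hp, hpm⟩ := hcomp.exists_isMaxOn hne.closure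
    (f := fun q : ℝ × ℝ => Real.sin (θ s₀) * q.1 - Real.cos (θ s₀) * q.2) (by fun_prop)
  have hpf : p ∈ frontier Om := by
    rw [hopen.frontier_eq]
    refine ⟨hp, fun hpO => ?_⟩
    have hcont : Continuous fun t : ℝ => p + t • (Real.sin (θ s₀), -Real.cos (θ s₀)) := by fun_prop
    have hev : ∀ᶠ t in nhds (0 : ℝ), p + t • (Real.sin (θ s₀), -Real.cos (θ s₀)) ∈ Om := by
      apply hcont.continuousAt.eventually_mem
      simpa using hopen.mem_nhds hpO
    have hev' := hev.filter_mono (nhdsWithin_le_nhds (s := Set.Ioi 0))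
    obtain ⟨t, ht, ht0⟩ := (hev'.and self_mem_nhdsWithin).exists
    have h := hpm (subset_closure ht)
    simp at h ht0
    nlinarith [Real.sin_sq_add_cos_sq (θ s₀)]
  rw [← hrange] at hpf
  obtain ⟨s₁, rfl⟩ := hpf
  have hcl : ∀ s, γ s ∈ closure Om := fun s =>
    frontier_subset_closure (hrange ▸ Set.mem_range_self s)
  have := support_point hL hθmono hθc hγ hγper hθper s₀ s₁ (fun s => hpm (hcl s))
  intro q hq
  rw [← this]
  exact hpm hq

lemma antipode {Om : Set (ℝ × ℝ)} (hopen : IsOpen Om) (hne : Om.Nonempty)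
    (hbdd : Bornology.IsBounded Om) (hsymm : ∀ p ∈ Om, -p ∈ Om)
    {γ : ℝ → ℝ × ℝ} {θ : ℝ → ℝ} {L : ℝ} (hL : 0 < L)
    (hθmono : StrictMono θ) (hθc : Continuous θ)
    (hγ : ∀ s, HasDerivAt γ (Real.cos (θ s), Real.sin (θ s)) s)
    (hγper : ∀ s, γ (s + L) = γ s) (hθper : ∀ s, θ (s + L) = θ s + 2 * π)
    (hrange : Set.range γ = frontier Om) (s s' : ℝ) (hs : θ s' = θ s + π) : γ s' = -γ s := by
  have hcl : ∀ s, γ s ∈ closure Om := fun s =>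
    frontier_subset_closure (hrange ▸ Set.mem_range_self s)
  have hneg : ∀ q ∈ closure Om, -q ∈ closure Om := fun q hq =>
    map_mem_closure continuous_neg hq hsymm
  have hf : -γ s ∈ Set.range γ := by
    rw [hrange, hopen.frontier_eq]
    refine ⟨hneg _ (hcl s), fun h => ?_⟩
    have h1 := hsymm _ h
    rw [neg_neg] at h1
    have h2 : γ s ∈ frontier Om := hrange ▸ Set.mem_range_self s
    rw [hopen.frontier_eq] at h2
    exact h2.2 h1
  obtain ⟨s₂, e⟩ := hf
  rw [← e]
  symm
  apply support_point hL hθmono hθc hγ hγper hθper s' s₂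
  intro t
  have := support_max hopen hne hbdd hL hθmono hθc hγ hγper hθper hrange s (-γ t) (hneg _ (hcl t))
  rw [e, hs, Real.sin_add_pi, Real.cos_add_pi]
  simp only [Prod.fst_neg, Prod.snd_neg] at *
  linarith

lemma half_period {γ : ℝ → ℝ × ℝ} {θ : ℝ → ℝ} {L : ℝ} (hL : 0 < L)
    (hθd : Differentiable ℝ θ) (hθpos : ∀ s, 0 < deriv θ s)
    (hγ : ∀ s, HasDerivAt γ (Real.cos (θ s), Real.sin (θ s)) s)
    (hθper : ∀ s, θ (s + L) = θ s + 2 * π)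
    (hanti : ∀ s s', θ s' = θ s + π → γ s' = -γ s) :
    ∀ s, γ (s + L / 2) = -γ s ∧ θ (s + L / 2) = θ s + π := by
  have hθmono : StrictMono θ := strictMono_of_deriv_pos hθpos
  have hsurj : Function.Surjective θ := by
    intro y
    apply mem_range_of_exists_le_of_exists_ge hθd.continuous
    · obtain ⟨n, hn⟩ := exists_int_lt ((y - θ 0) / (2 * π))
      refine ⟨0 + n * L, ?_⟩
      rw [theta_int hL hθper]
      rw [lt_div_iff₀ (by positivity)] at hn
      linarith
    · obtain ⟨n, hn⟩ := exists_int_gt ((y - θ 0) / (2 * π))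
      refine ⟨0 + n * L, ?_⟩
      rw [theta_int hL hθper]
      rw [div_lt_iff₀ (by positivity)] at hn
      linarith
  let e := StrictMono.orderIsoOfSurjective θ hθmono hsurj
  have hge : ∀ y, θ (e.symm y) = y := fun y => e.apply_symm_apply y
  have hgd : ∀ y, HasDerivAt e.symm (deriv θ (e.symm y))⁻¹ y := by
    intro y
    exact HasDerivAt.of_local_left_inverse e.symm.continuous.continuousAt
      (hθd _).hasDerivAt (hθpos _).ne' (Filter.Eventually.of_forall hge)
  let σ : ℝ → ℝ := fun s => e.symm (θ s + π)
  have hσθ : ∀ s, θ (σ s) = θ s + π := fun s => hge _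
  have hσd : ∀ s, HasDerivAt σ 1 s := by
    intro s
    have h1 : HasDerivAt σ ((deriv θ (σ s))⁻¹ * deriv θ s) s :=
      (hgd (θ s + π)).comp s ((hθd s).hasDerivAt.add_const π)
    have h2 := (hγ (σ s)).scomp s h1
    have h3 : γ ∘ σ = fun s => -γ s := funext fun s => hanti s _ (hσθ s)
    rw [h3] at h2
    have h4 := h2.unique (hγ s).fun_neg
    rw [hσθ, Real.cos_add_pi, Real.sin_add_pi] at h4
    set d := (deriv θ (σ s))⁻¹ * deriv θ s
    have h5 := congrArg Prod.fst h4
    have h6 := congrArg Prod.snd h4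
    simp at h5 h6
    have h7 : d = 1 := by
      have := Real.sin_sq_add_cos_sq (θ s)
      linear_combination (1 - d) * this + Real.cos (θ s) * h5 + Real.sin (θ s) * h6
    rwa [h7] at h1
  have hconst : ∀ s, σ s - s = σ 0 - 0 := by
    intro s
    have hd : ∀ s, HasDerivAt (fun s => σ s - s) 0 s := fun s => by
      
      have := (hσd s).sub (hasDerivAt_id s)
      rw [sub_self] at this
      exact this
    exact is_const_of_deriv_eq_zero (fun s => (hd s).differentiableAt) (fun s => (hd s).deriv) s 0
  have ha : σ 0 = L / 2 := by
    have h1 : θ (σ (σ 0)) = θ (0 + L) := by rw [hσθ, hσθ, hθper]; ring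
    have h2 := hθmono.injective h1
    have h3 := hconst (σ 0)
    linarith
  intro s
  have hs : s + L / 2 = σ s := by have := hconst s; linarith
  rw [hs]
  exact ⟨hanti s _ (hσθ s), hσθ s⟩

end symmetry

section zeros

lemma two_zeros {φ f : ℝ → ℝ} (hd : ∀ s, HasDerivAt φ (f s) s) (hf : Continuous f) {a p b : ℝ}
    (hap : a < p) (hpb : p < b) (hp : 0 < f p) (h1 : φ p ≤ φ a) (h2 : φ b ≤ φ p) :
    (∃ z ∈ Set.Ioo a p, f z = 0) ∧ (∃ z ∈ Set.Ioo p b, f z = 0) := by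
  have hφ : Continuous φ := continuous_iff_continuousAt.2 fun s => (hd s).continuousAt
  constructor
  · by_contra! hno
    have hpos : ∀ x ∈ Set.Ioo a p, 0 < f x := by
      intro x hx
      by_contra! hle
      obtain ⟨z, hz, e⟩ := intermediate_value_Icc hx.2.le hf.continuousOn
        (show (0 : ℝ) ∈ Set.Icc (f x) (f p) from ⟨hle, hp.le⟩)
      refine hno z ⟨hx.1.trans_le hz.1, lt_of_le_of_ne hz.2 ?_⟩ e
      rintro rfl; exact hp.ne' e
    have hm : StrictMonoOn φ (Set.Icc a p) := by
      apply strictMonoOn_of_deriv_pos (convex_Icc _ _) hφ.continuousOn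
      intro x hx
      rw [interior_Icc] at hx
      rw [(hd x).deriv]; exact hpos x hx
    exact absurd (hm (Set.left_mem_Icc.2 hap.le) (Set.right_mem_Icc.2 hap.le) hap) (not_lt.2 h1)
  · by_contra! hno
    have hpos : ∀ x ∈ Set.Ioo p b, 0 < f x := by
      intro x hx
      by_contra! hle
      obtain ⟨z, hz, e⟩ := intermediate_value_Icc' hx.1.le hf.continuousOn
        (show (0 : ℝ) ∈ Set.Icc (f x) (f p) from ⟨hle, hp.le⟩)
      refine hno z ⟨lt_of_le_of_ne hz.1 ?_, hz.2.trans_lt hx.2⟩ e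
      rintro rfl; exact hp.ne' e
    have hm : StrictMonoOn φ (Set.Icc p b) := by
      apply strictMonoOn_of_deriv_pos (convex_Icc _ _) hφ.continuousOn
      intro x hx
      rw [interior_Icc] at hx
      rw [(hd x).deriv]; exact hpos x hx
    exact absurd (hm (Set.left_mem_Icc.2 hpb.le) (Set.right_mem_Icc.2 hpb.le) hpb) (not_lt.2 h2)

lemma four_zeros {φ f θ : ℝ → ℝ} {P : ℝ} (hP : 0 < P) (hd : ∀ s, HasDerivAt φ (f s) s)
    (hf : Continuous f) (hφper : Function.Periodic φ P) (hfper : Function.Periodic f P)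
    (hθmono : StrictMono θ) (hθc : Continuous θ) (hθper : ∀ s, θ (s + P) = θ s + π)
    (hcos : ∫ s in (0 : ℝ)..P, f s * Real.cos (2 * θ s) = 0)
    (hsin : ∫ s in (0 : ℝ)..P, f s * Real.sin (2 * θ s) = 0) (hne : ∃ x, f x ≠ 0) :
    ∃ z₁ z₂ z₃ z₄, z₁ < z₂ ∧ z₂ < z₃ ∧ z₃ < z₄ ∧ z₄ < z₁ + P ∧
      f z₁ = 0 ∧ f z₂ = 0 ∧ f z₃ = 0 ∧ f z₄ = 0 := by
  have hφ : Continuous φ := continuous_iff_continuousAt.2 fun s => (hd s).continuousAt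
  obtain ⟨a, -, ha'⟩ := (isCompact_Icc (a := (0 : ℝ)) (b := P)).exists_isMaxOn
    (Set.nonempty_Icc.2 hP.le) hφ.continuousOn
  have ha : ∀ x, φ x ≤ φ a := by
    intro x
    obtain ⟨y, hy, e⟩ := hφper.exists_mem_Ico₀ hP x
    rw [e]; exact ha' ⟨hy.1, hy.2.le⟩
  obtain ⟨b', -, hb'⟩ := (isCompact_Icc (a := (0 : ℝ)) (b := P)).exists_isMinOn
    (Set.nonempty_Icc.2 hP.le) hφ.continuousOn
  obtain ⟨b, hbm, eb⟩ := hφper.exists_mem_Ico hP b' a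
  have hb : ∀ x, φ b ≤ φ x := by
    intro x
    obtain ⟨y, hy, e⟩ := hφper.exists_mem_Ico₀ hP x
    rw [e, ← eb]; exact hb' ⟨hy.1, hy.2.le⟩
  have fa : f a = 0 := IsLocalMax.hasDerivAt_eq_zero (Filter.Eventually.of_forall ha) (hd a)
  have fb : f b = 0 := IsLocalMin.hasDerivAt_eq_zero (Filter.Eventually.of_forall hb) (hd b)
  have hab : a < b := by
    refine lt_of_le_of_ne hbm.1 ?_
    rintro rfl
    obtain ⟨x, hx⟩ := hne
    apply hx
    have : IsLocalMax φ x := Filter.Eventually.of_forall fun y => (ha y).trans (hb x)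
    exact this.hasDerivAt_eq_zero (hd x)
  have hbP : b < a + P := hbm.2
  -- the trigonometric test function
  let T : ℝ → ℝ := fun s => Real.sin (θ s - θ a) * Real.sin (θ s - θ b)
  have hTc : Continuous T := by fun_prop
  have hint : ∫ s in a..(a + P), f s * T s = 0 := by
    have hper : Function.Periodic (fun s => f s * T s) P := by
      intro s
      simp only [T, hfper s, hθper]
      rw [show θ s + π - θ a = θ s - θ a + π by ring, show θ s + π - θ b = θ s - θ b + π by ring,
        Real.sin_add_pi, Real.sin_add_pi]
      ring
    rw [hper.intervalIntegral_add_eq a 0, zero_add]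
    have e : ∀ s, f s * T s = (Real.cos (θ b - θ a) / 2) * f s
        - (Real.cos (θ a + θ b) / 2) * (f s * Real.cos (2 * θ s))
        - (Real.sin (θ a + θ b) / 2) * (f s * Real.sin (2 * θ s)) := by
      intro s
      simp only [T, Real.sin_sub, Real.cos_sub, Real.cos_add, Real.sin_add, Real.cos_two_mul,
        Real.sin_two_mul]
      have h1 := Real.sin_sq_add_cos_sq (θ s)
      linear_combination f s * (Real.cos (θ a) * Real.cos (θ b) ) * h1
    have i0 : IntervalIntegrable f volume 0 P := hf.intervalIntegrable _ _
    have i1 : IntervalIntegrable (fun s => f s * Real.cos (2 * θ s)) volume 0 P :=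
      Continuous.intervalIntegrable (by fun_prop) _ _
    have i2 : IntervalIntegrable (fun s => f s * Real.sin (2 * θ s)) volume 0 P :=
      Continuous.intervalIntegrable (by fun_prop) _ _
    have hz : ∫ s in (0 : ℝ)..P, f s = 0 := by
      rw [intervalIntegral.integral_eq_sub_of_hasDerivAt (fun s _ => hd s) i0]
      have := hφper 0
      rw [zero_add] at this
      rw [this, sub_self]
    simp_rw [e]
    rw [intervalIntegral.integral_sub ((i0.const_mul _).sub (i1.const_mul _)) (i2.const_mul _),
      intervalIntegral.integral_sub (i0.const_mul _) (i1.const_mul _)]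
    simp only [intervalIntegral.integral_const_mul, hcos, hsin, hz]
    simp
  have hT1 : ∀ s ∈ Set.Ioo a b, T s < 0 := by
    intro s hs
    have h1 := hθmono hs.1
    have h2 := hθmono hs.2
    have h3 := hθmono hbP
    rw [hθper] at h3
    exact mul_neg_of_pos_of_neg (Real.sin_pos_of_pos_of_lt_pi (by linarith) (by linarith))
      (Real.sin_neg_of_neg_of_neg_pi_lt (by linarith) (by linarith))
  have hT2 : ∀ s ∈ Set.Ioo b (a + P), 0 < T s := by
    intro s hs
    have h1 := hθmono hs.1
    have h2 := hθmono hs.2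
    have h3 := hθmono hab
    rw [hθper] at h2
    exact mul_pos (Real.sin_pos_of_pos_of_lt_pi (by linarith) (by linarith))
      (Real.sin_pos_of_pos_of_lt_pi (by linarith) (by linarith))
  have faP : f (a + P) = 0 := by rw [hfper a, fa]
  by_cases hc1 : ∃ p ∈ Set.Ioo a b, 0 < f p
  · obtain ⟨p, hp, hp0⟩ := hc1
    obtain ⟨⟨z, hz, ez⟩, ⟨w, hw, ew⟩⟩ := two_zeros hd hf hp.1 hp.2 hp0 (ha p) (hb p)
    exact ⟨a, z, w, b, hz.1, hz.2.trans hw.1, hw.2, hbP, fa, ez, ew, fb⟩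
  by_cases hc2 : ∃ p ∈ Set.Ioo b (a + P), f p < 0
  · obtain ⟨p, hp, hp0⟩ := hc2
    obtain ⟨⟨z, hz, ez⟩, ⟨w, hw, ew⟩⟩ := two_zeros (φ := fun s => -φ s) (f := fun s => -f s)
      (fun s => (hd s).neg) hf.neg hp.1 hp.2 (by linarith) (neg_le_neg (hb p))
      (by rw [hφper a]; exact neg_le_neg (ha p))
    exact ⟨a, b, z, w, hab, hz.1, hz.2.trans hw.1, hw.2, fa, fb, by linarith, by linarith⟩
  exfalso
  push Not at hc1 hc2
  have hnn : ∀ s ∈ Set.Ioc a (a + P), 0 ≤ f s * T s := by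
    intro s hs
    rcases lt_trichotomy s b with h | h | h
    · exact mul_nonneg_of_nonpos_of_nonpos (hc1 s ⟨hs.1, h⟩) (hT1 s ⟨hs.1, h⟩).le
    · rw [h, fb, zero_mul]
    · rcases eq_or_lt_of_le hs.2 with h' | h'
      · rw [h', faP, zero_mul]
      · exact mul_nonneg (hc2 s ⟨h, h'⟩) (hT2 s ⟨h, h'⟩).le
  obtain ⟨x, hx⟩ := hne
  obtain ⟨y, hy, ey⟩ := hfper.exists_mem_Ico hP x a
  rw [ey] at hx
  have hya : a < y := lt_of_le_of_ne hy.1 (by rintro rfl; exact hx fa)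
  have hTy : T y ≠ 0 := by
    rcases lt_trichotomy y b with h | h | h
    · exact (hT1 y ⟨hya, h⟩).ne
    · rw [h] at hx; exact absurd fb hx
    · exact (hT2 y ⟨h, hy.2⟩).ne'
  have := intervalIntegral.integral_pos (by linarith : a < a + P) (hf.mul hTc).continuousOn hnn
    ⟨y, ⟨hy.1, hy.2.le⟩, lt_of_le_of_ne (hnn y ⟨hya, hy.2.le⟩) (mul_ne_zero hx hTy).symm⟩
  exact this.ne' hint

lemma eight_zeros {φ f θ : ℝ → ℝ} {L : ℝ} (hL : 0 < L) (hd : ∀ s, HasDerivAt φ (f s) s)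
    (hf : Continuous f) (hφper : Function.Periodic φ (L / 2))
    (hfper : Function.Periodic f (L / 2))
    (hθmono : StrictMono θ) (hθc : Continuous θ) (hθper : ∀ s, θ (s + L / 2) = θ s + π)
    (hcos : ∫ s in (0 : ℝ)..(L / 2), f s * Real.cos (2 * θ s) = 0)
    (hsin : ∫ s in (0 : ℝ)..(L / 2), f s * Real.sin (2 * θ s) = 0) :
    ∃ t : Fin 8 → ℝ, Function.Injective t ∧ ∀ i, t i ∈ Set.Ico 0 L ∧ f (t i) = 0 := by
  by_cases hne : ∃ x, f x ≠ 0
  · obtain ⟨z₁, z₂, z₃, z₄, h12, h23, h34, h41, e1, e2, e3, e4⟩ :=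
      four_zeros (by linarith) hd hf hφper hfper hθmono hθc hθper hcos hsin hne
    have hfL : Function.Periodic f L := by
      have := hfper.add_period hfper
      rwa [add_halves] at this
    let z : Fin 8 → ℝ := ![z₁, z₂, z₃, z₄, z₁ + L / 2, z₂ + L / 2, z₃ + L / 2, z₄ + L / 2]
    have hz : StrictMono z := by
      rw [Fin.strictMono_iff_lt_succ]
      intro i
      fin_cases i <;> simp [z] <;> linarith
    have hzm : ∀ i, z i ∈ Set.Ico z₁ (z₁ + L) := by
      intro i
      fin_cases i <;> simp only [z, Set.mem_Ico] <;> simp <;> (try constructor) <;> linarith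
    have hz0 : ∀ i, f (z i) = 0 := by
      intro i
      fin_cases i <;> simp [z, hfper _, e1, e2, e3, e4]
    refine ⟨fun i => toIcoMod hL 0 (z i), ?_, fun i => ⟨?_, ?_⟩⟩
    · intro i j hij
      apply hz.injective
      rw [← (toIcoMod_eq_self hL).2 (hzm i), ← (toIcoMod_eq_self hL).2 (hzm j)]
      simp only at hij
      rw [toIcoMod_inj] at hij ⊢
      exact hij
    · simpa using toIcoMod_mem_Ico hL 0 (z i)
    · have : toIcoMod hL 0 (z i) = z i - toIcoDiv hL 0 (z i) • L := rfl
      show f (toIcoMod hL 0 (z i)) = 0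
      rw [this, hfL.sub_zsmul_eq, hz0]
  · push Not at hne
    refine ⟨fun i => (i : ℝ) * (L / 8), ?_, fun i => ⟨⟨by positivity, ?_⟩, hne _⟩⟩
    · intro i j hij
      have h8 : L / 8 ≠ 0 := by positivity
      have := mul_right_cancel₀ h8 hij
      exact Fin.ext (by exact_mod_cast this)
    · have : ((i : ℕ) : ℝ) < 8 := by exact_mod_cast i.2
      nlinarith

end zeros

/-- With `g(θ) = (∂(Rω)/∂n)·(1/κ)` as a function of the tangent
angle `θ`, the integrals `∫₀^{2π} g·cos kθ dθ` and `∫₀^{2π} g·sin kθ dθ` vanish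
for `k = 0,1,2,3` (expressed via the substitution `θ = θ(s)`, `dθ = θ'(s) ds`);
consequently `∂(Rω)/∂n` has at least 8 zeros along `∂Ω`. -/
theorem normal_derivative_rotation_eight_zeros
    (Om : Set (ℝ × ℝ)) (hopen : IsOpen Om) (hconn : IsConnected Om)
    (hbdd : Bornology.IsBounded Om)
    (hconvex : StrictConvex ℝ Om)
    (hsymm : ∀ p ∈ Om, -p ∈ Om)
    (L : ℝ) (hL : 0 < L)
    (γ : ℝ → ℝ × ℝ) (θ : ℝ → ℝ)
    (hγsmooth : ContDiff ℝ (⊤ : ℕ∞) γ) (hθsmooth : ContDiff ℝ (⊤ : ℕ∞) θ)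
    (hγper : ∀ s, γ (s + L) = γ s)
    (hθper : ∀ s, θ (s + L) = θ s + 2 * π)
    (hrange : Set.range γ = frontier Om)
    (hinj : Set.InjOn γ (Set.Ico 0 L))
    (hγderiv : ∀ s, deriv γ s = (Real.cos (θ s), Real.sin (θ s)))
    (hκneg : ∀ s, -deriv θ s < 0)
    (ω : ℝ × ℝ → ℝ) (μ : ℝ) (c : ℝ) (hμpos : 0 < μ) (hc : c ≠ 0)
    (hωsmooth : SmoothNearClosure Om ω)
    (hωpde : ∀ p ∈ Om, - lap ω p = μ * ω p)
    (hωNeumann : ∀ s, nderiv (θ s) ω (γ s) = 0)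
    (hωbdry : ∀ p ∈ frontier Om, ω p = c)
 :
    (∀ k : ℕ, k ≤ 3 →
      (∫ s in (0 : ℝ)..L,
          nderiv (θ s) (Rop ω) (γ s) * (1 / (-deriv θ s)) * Real.cos (k * θ s)
            * deriv θ s) = 0
      ∧ (∫ s in (0 : ℝ)..L,
          nderiv (θ s) (Rop ω) (γ s) * (1 / (-deriv θ s)) * Real.sin (k * θ s)
            * deriv θ s) = 0)
    ∧ (∃ t : Fin 8 → ℝ, Function.Injective t ∧
        ∀ i, t i ∈ Set.Ico 0 L ∧ nderiv (θ (t i)) (Rop ω) (γ (t i)) = 0) := by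
  obtain ⟨U, hU, hOU, hωU⟩ := hωsmooth
  have hω : Sm ω U := hωU
  have hOmU : Om ⊆ U := subset_closure.trans hOU
  have hθd : Differentiable ℝ θ := hθsmooth.differentiable (by simp)
  have hθc : Continuous θ := hθd.continuous
  have hθpos : ∀ s, 0 < deriv θ s := fun s => by linarith [hκneg s]
  have hθmono : StrictMono θ := strictMono_of_deriv_pos hθpos
  have hγ : ∀ s, HasDerivAt γ (Real.cos (θ s), Real.sin (θ s)) s := fun s => by
    rw [← hγderiv s]
    exact (hγsmooth.differentiable (by simp) s).hasDerivAt
  have hγf : ∀ s, γ s ∈ frontier Om := fun s => hrange ▸ Set.mem_range_self s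
  have hcl : ∀ s, γ s ∈ closure Om := fun s => frontier_subset_closure (hγf s)
  have hγU : ∀ s, γ s ∈ U := fun s => hOU (hcl s)
  have hconv : Convex ℝ Om := hconvex.convex
  have h0 : (0 : ℝ × ℝ) ∈ Om := by
    obtain ⟨p, hp⟩ := hconn.nonempty
    have := hconv hp (hsymm p hp) (a := 1 / 2) (b := 1 / 2) (by norm_num) (by norm_num)
      (by norm_num)
    simpa using this
  have hhalf := half_period hL hθd hθpos hγ hθper
    (antipode hopen hconn.nonempty hbdd hsymm hL hθmono hθc hγ hγper hθper hrange)
  -- the Helmholtz equation holds for `ω` in `Om`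
  have hH : Helm μ ω Om := fun p hp => by have := hωpde p hp; linarith
  have hωO : Sm ω Om := hω.mono hOmU
  have hx := hω.pdx hU
  have hy := hω.pdy hU
  have hxx := hx.pdx hU
  have hyy := hy.pdy hU
  have hxy := hy.pdx hU
  -- the equation on the boundary
  have hbd : ∀ s, pdx (pdx ω) (γ s) + pdy (pdy ω) (γ s) = -μ * c := by
    intro s
    have hcc : ContinuousOn (fun p => pdx (pdx ω) p + pdy (pdy ω) p + μ * ω p) (closure Om) :=
      ((hxx.continuousOn.add hyy.continuousOn).add (continuousOn_const.mul hω.continuousOn)).mono hOU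
    have hz : Set.EqOn (fun p => pdx (pdx ω) p + pdy (pdy ω) p + μ * ω p) (fun _ => 0) Om := by
      intro p hp
      have := hH p hp
      unfold lap at this
      simp only
      linarith
    have := hz.of_subset_closure hcc continuousOn_const subset_closure le_rfl (hcl s)
    simp only [hωbdry _ (hγf s)] at this
    linarith
  have hgrad : ∀ s, pdx ω (γ s) = 0 ∧ pdy ω (γ s) = 0 := by
    intro s
    have h1 := hω.grad_chain hU (hγ s) (hγU s)
    have h2 : (fun s => ω (γ s)) = fun _ => c := funext fun s => hωbdry _ (hγf s)
    rw [h2] at h1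
    have h3 := h1.unique (hasDerivAt_const s c)
    have h4 := hωNeumann s
    unfold nderiv at h4
    have h5 := Real.sin_sq_add_cos_sq (θ s)
    constructor
    · linear_combination Real.cos (θ s) * h3 + Real.sin (θ s) * h4 - pdx ω (γ s) * h5
    · linear_combination Real.sin (θ s) * h3 - Real.cos (θ s) * h4 - pdy ω (γ s) * h5
  have hhess : ∀ s, pdx (pdx ω) (γ s) = -μ * c * Real.sin (θ s) ^ 2 ∧
      pdx (pdy ω) (γ s) = μ * c * (Real.sin (θ s) * Real.cos (θ s)) ∧
      pdy (pdy ω) (γ s) = -μ * c * Real.cos (θ s) ^ 2 := by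
    intro s
    have h1 := hx.grad_chain hU (hγ s) (hγU s)
    rw [funext fun s => (hgrad s).1] at h1
    have h1' := h1.unique (hasDerivAt_const s 0)
    have h2 := hy.grad_chain hU (hγ s) (hγU s)
    rw [funext fun s => (hgrad s).2] at h2
    have h2' := h2.unique (hasDerivAt_const s 0)
    rw [hω.comm hU (hγU s)] at h1'
    have h3 := hbd s
    have h5 := Real.sin_sq_add_cos_sq (θ s)
    set A := pdx (pdx ω) (γ s)
    set B := pdx (pdy ω) (γ s)
    set D := pdy (pdy ω) (γ s)
    set S := Real.sin (θ s)
    set C := Real.cos (θ s)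
    refine ⟨?_, ?_, ?_⟩
    · linear_combination C * h1' - S * h2' + S ^ 2 * h3 - A * h5
    · linear_combination S * h1' + C * h2' - S * C * h3 - B * h5
    · linear_combination S * h2' - C * h1' + C ^ 2 * h3 - D * h5
  -- the normal derivative of the rotation
  let h : ℝ → ℝ := fun s => (γ s).1 * Real.cos (θ s) + (γ s).2 * Real.sin (θ s)
  have hn : ∀ s, nderiv (θ s) (Rop ω) (γ s) = μ * c * h s := by
    intro s
    obtain ⟨a1, a2, a3⟩ := hhess s
    obtain ⟨b1, b2⟩ := hgrad s
    rw [nderiv, pdx_Rop hω hU (hγU s), pdy_Rop hω hU (hγU s), b1, b2, Rop, Rop,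
      hω.comm hU (hγU s), a1, a2, a3]
    have h5 := Real.sin_sq_add_cos_sq (θ s)
    simp only [h]
    linear_combination μ * c * ((γ s).1 * Real.cos (θ s) + (γ s).2 * Real.sin (θ s)) * h5
  have hR0 : ∀ s, Rop ω (γ s) = 0 := by
    intro s
    rw [Rop, (hgrad s).1, (hgrad s).2]; ring
  have hμc : μ * c ≠ 0 := mul_ne_zero hμpos.ne' hc
  have hγL : γ L = γ 0 := by simpa using hγper 0
  have hγc : Continuous γ := continuous_iff_continuousAt.2 fun s => (hγ s).continuousAt
  have hhc : Continuous h := by fun_prop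
  -- Green's formula
  have hcos2 : ∫ s in (0 : ℝ)..L, h s * Real.cos (2 * θ s) = 0 := by
    have g := green_helm hopen hconv h0 hU hOU (hω.Rop hU) (hxx.sub hyy) (hH.Rop hωO hopen)
      (Helm.sub ((hH.pdx hωO hopen).pdx (hωO.pdx hopen) hopen)
        ((hH.pdy hωO hopen).pdy (hωO.pdy hopen) hopen)
        ((hωO.pdx hopen).pdx hopen) ((hωO.pdy hopen).pdy hopen) hopen) hθc hγ hγL hcl hR0
    have e : ∀ s, nderiv (θ s) (Rop ω) (γ s) * (pdx (pdx ω) (γ s) - pdy (pdy ω) (γ s))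
        = (μ * c) ^ 2 * (h s * Real.cos (2 * θ s)) := by
      intro s
      obtain ⟨a1, a2, a3⟩ := hhess s
      rw [hn, a1, a3, Real.cos_two_mul']
      ring
    simp only [e] at g
    rw [intervalIntegral.integral_const_mul] at g
    exact (mul_eq_zero.1 g).resolve_left (pow_ne_zero 2 hμc)
  have hsin2 : ∫ s in (0 : ℝ)..L, h s * Real.sin (2 * θ s) = 0 := by
    have g := green_helm hopen hconv h0 hU hOU (hω.Rop hU) hxy (hH.Rop hωO hopen)
      ((hH.pdy hωO hopen).pdx (hωO.pdy hopen) hopen) hθc hγ hγL hcl hR0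
    have e : ∀ s, nderiv (θ s) (Rop ω) (γ s) * (pdx (pdy ω) (γ s))
        = (μ * c) ^ 2 / 2 * (h s * Real.sin (2 * θ s)) := by
      intro s
      obtain ⟨a1, a2, a3⟩ := hhess s
      rw [hn, a2, Real.sin_two_mul]
      ring
    simp only [e] at g
    rw [intervalIntegral.integral_const_mul] at g
    exact (mul_eq_zero.1 g).resolve_left (div_ne_zero (pow_ne_zero 2 hμc) two_ne_zero)
  -- the primitive of `h`
  let φ : ℝ → ℝ := fun s => ((γ s).1 ^ 2 + (γ s).2 ^ 2) / 2
  have hφd : ∀ s, HasDerivAt φ (h s) s := by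
    intro s
    have h1 : HasDerivAt (fun s => (γ s).1) (Real.cos (θ s)) s :=
      (hasFDerivAt_fst (𝕜 := ℝ) (p := γ s)).comp_hasDerivAt s (hγ s)
    have h2 : HasDerivAt (fun s => (γ s).2) (Real.sin (θ s)) s :=
      (hasFDerivAt_snd (𝕜 := ℝ) (p := γ s)).comp_hasDerivAt s (hγ s)
    have h3 := ((h1.fun_pow 2).fun_add (h2.fun_pow 2)).div_const 2
    convert! h3 using 1
    simp only [h]
    push_cast
    ring
  have hφper : Function.Periodic φ (L / 2) := by
    intro s
    simp only [φ, (hhalf s).1, Prod.fst_neg, Prod.snd_neg]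
    ring
  have hhper : Function.Periodic h (L / 2) := by
    intro s
    simp only [h, (hhalf s).1, (hhalf s).2, Prod.fst_neg, Prod.snd_neg, Real.cos_add_pi,
      Real.sin_add_pi]
    ring
  -- splitting of integrals over the two halves
  have hsplit : ∀ (F : ℝ → ℝ) (ε : ℝ), Continuous F → (∀ s, F (s + L / 2) = ε * F s) →
      ∫ s in (0 : ℝ)..L, F s = (1 + ε) * ∫ s in (0 : ℝ)..(L / 2), F s := by
    intro F ε hF hFs
    rw [← intervalIntegral.integral_add_adjacent_intervals (hF.intervalIntegrable 0 (L / 2))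
      (hF.intervalIntegrable (L / 2) L)]
    have e : ∫ s in (L / 2)..L, F s = ∫ s in (0 : ℝ)..(L / 2), F (s + L / 2) := by
      rw [intervalIntegral.integral_comp_add_right]
      congr 1 <;> ring
    rw [e]
    simp only [hFs]
    rw [intervalIntegral.integral_const_mul]
    ring
  refine ⟨?_, ?_⟩
  · -- reduction to `h`
    have hred : ∀ G : ℝ → ℝ, (∫ s in (0 : ℝ)..L, h s * G s = 0) →
        (∫ s in (0 : ℝ)..L,
          nderiv (θ s) (Rop ω) (γ s) * (1 / (-deriv θ s)) * G s * deriv θ s) = 0 := by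
      intro G hG
      have e : ∀ s, nderiv (θ s) (Rop ω) (γ s) * (1 / (-deriv θ s)) * G s * deriv θ s
          = (-(μ * c)) * (h s * G s) := by
        intro s
        have := (hθpos s).ne'
        rw [hn]
        field_simp
      simp only [e]
      rw [intervalIntegral.integral_const_mul, hG, mul_zero]
    intro k hk
    refine ⟨hred (fun s => Real.cos (k * θ s)) ?_, hred (fun s => Real.sin (k * θ s)) ?_⟩
    · interval_cases k
      · simp only [Nat.cast_zero, zero_mul, Real.cos_zero, mul_one]
        rw [intervalIntegral.integral_eq_sub_of_hasDerivAt (fun s _ => hφd s)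
          (hhc.intervalIntegrable _ _)]
        simp [φ, hγL]
      · rw [hsplit _ (-1) (by fun_prop) ?_]
        · ring
        · intro s
          rw [hhper s, (hhalf s).2]
          rw [show ((1 : ℕ) : ℝ) * (θ s + π) = ((1 : ℕ) : ℝ) * θ s + π by push_cast; ring,
            Real.cos_add_pi]
          ring
      · simpa using hcos2
      · rw [hsplit _ (-1) (by fun_prop) ?_]
        · ring
        · intro s
          rw [hhper s, (hhalf s).2]
          rw [show ((3 : ℕ) : ℝ) * (θ s + π) = ((3 : ℕ) : ℝ) * θ s + π + 2 * π by push_cast; ring,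
            Real.cos_add_two_pi, Real.cos_add_pi]
          ring
    · interval_cases k
      · simp
      · rw [hsplit _ (-1) (by fun_prop) ?_]
        · ring
        · intro s
          rw [hhper s, (hhalf s).2]
          rw [show ((1 : ℕ) : ℝ) * (θ s + π) = ((1 : ℕ) : ℝ) * θ s + π by push_cast; ring,
            Real.sin_add_pi]
          ring
      · simpa using hsin2
      · rw [hsplit _ (-1) (by fun_prop) ?_]
        · ring
        · intro s
          rw [hhper s, (hhalf s).2]
          rw [show ((3 : ℕ) : ℝ) * (θ s + π) = ((3 : ℕ) : ℝ) * θ s + π + 2 * π by push_cast; ring,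
            Real.sin_add_two_pi, Real.sin_add_pi]
          ring
  · have hc' : ∫ s in (0 : ℝ)..(L / 2), h s * Real.cos (2 * θ s) = 0 := by
      rw [hsplit _ 1 (by fun_prop) ?_] at hcos2
      · linarith
      · intro s
        rw [hhper s, (hhalf s).2, mul_add, Real.cos_add_two_pi]; ring
    have hs' : ∫ s in (0 : ℝ)..(L / 2), h s * Real.sin (2 * θ s) = 0 := by
      rw [hsplit _ 1 (by fun_prop) ?_] at hsin2
      · linarith
      · intro s
        rw [hhper s, (hhalf s).2, mul_add, Real.sin_add_two_pi]; ring
    obtain ⟨t, ht, ht'⟩ := eight_zeros hL hφd hhc hφper hhper hθmono hθc (fun s => (hhalf s).2)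
      hc' hs'
    exact ⟨t, ht, fun i => ⟨(ht' i).1, by rw [hn, (ht' i).2, mul_zero]⟩⟩
end
end

section
/- Let Ω be an open, bounded domain in R² with connected C^∞ boundary, symmetric under the map (x,y) ↦ (−x,−y), and let ω be a C^∞ solution of −Δω = μω in Ω with ∂ω/∂n = 0 on ∂Ω and ω = c ≠ 0 on ∂Ω for some μ > 0. Then ω is even: ω(−x, −y) = ω(x, y) for all (x, y) ∈ Ω, and consequently Rω = −y ω_x + x ω_y is also even on Ω, and the origin is a zero of both Rω and its gradient. -/
noncomputable section
open Real MeasureTheory ComplexConjugate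

/-- `z - a` has a continuous square root on `C`. -/
def HasRoot (C : Set ℂ) (a : ℂ) : Prop :=
  ∃ s : ℂ → ℂ, ContinuousOn s C ∧ ∀ z ∈ C, s z ^ 2 = z - a

lemma csqrt_sq (w : ℂ) : (w ^ ((1:ℂ)/2)) ^ 2 = w := by
  rw [← Complex.cpow_nat_mul]; norm_num

lemma sqrt_cont {C : Set ℂ} {f : ℂ → ℂ} (hf : ContinuousOn f C) (h : ∀ z ∈ C, ‖f z‖ < 1) :
    ContinuousOn (fun z => (1 + f z) ^ ((1:ℂ)/2)) C := by
  apply ContinuousOn.cpow (continuousOn_const.add hf) continuousOn_const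
  intro z hz
  exact Complex.mem_slitPlane_of_norm_lt_one (h z hz)

lemma HasRoot.move {C : Set ℂ} {a b : ℂ} (h : HasRoot C a) (hab : ∀ z ∈ C, ‖a - b‖ < ‖z - a‖) :
    HasRoot C b := by
  obtain ⟨s, hs, hsq⟩ := h
  have hne : ∀ z ∈ C, z - a ≠ 0 := fun z hz h0 => by
    have := hab z hz
    rw [h0, norm_zero] at this
    exact absurd this (not_lt.2 (norm_nonneg _))
  refine ⟨fun z => s z * (1 + (a - b) / (z - a)) ^ ((1:ℂ)/2), hs.mul (sqrt_cont ?_ ?_), ?_⟩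
  · exact continuousOn_const.div (continuousOn_id.sub continuousOn_const) hne
  · intro z hz
    rw [norm_div, div_lt_one (norm_pos_iff.2 (hne z hz))]
    exact hab z hz
  · intro z hz
    rw [mul_pow, hsq z hz, csqrt_sq]
    field_simp [hne z hz]
    ring

lemma hasRoot_far {C : Set ℂ} {b : ℂ} (h : ∀ z ∈ C, ‖z‖ < ‖b‖) : HasRoot C b := by
  by_cases hb : b = 0
  · subst hb
    have : C = ∅ := by
      ext z; simp only [Set.mem_empty_iff_false, iff_false]
      intro hz; have := h z hz; rw [norm_zero] at this
      exact absurd this (not_lt.2 (norm_nonneg _))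
    subst this
    exact ⟨id, continuousOn_empty _, by simp⟩
  refine ⟨fun z => (-b) ^ ((1:ℂ)/2) * (1 + (-z / b)) ^ ((1:ℂ)/2),
    continuousOn_const.mul (sqrt_cont (by fun_prop) ?_), ?_⟩
  · intro z hz
    rw [norm_div, norm_neg, div_lt_one (norm_pos_iff.2 hb)]
    exact h z hz
  · intro z hz
    rw [mul_pow, csqrt_sq, csqrt_sq]
    field_simp
    ring

lemma hasRoot_nhds {C : Set ℂ} (hC : IsClosed C) {a : ℂ} (ha : a ∉ C) :
    ∀ᶠ b in nhds a, (HasRoot C b ↔ HasRoot C a) := by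
  obtain ⟨r, hr, hball⟩ := Metric.isOpen_iff.1 hC.isOpen_compl a ha
  have hd : ∀ z ∈ C, r ≤ ‖z - a‖ := by
    intro z hz
    by_contra! hlt
    exact hball (by simpa [dist_eq_norm] using hlt) hz
  filter_upwards [Metric.ball_mem_nhds a (half_pos hr)] with b hb
  rw [Metric.mem_ball, dist_eq_norm] at hb
  constructor
  · intro h
    refine h.move fun z hz => ?_
    have h1 := hd z hz
    have h2 : ‖z - a‖ ≤ ‖z - b‖ + ‖b - a‖ := by
      simpa using norm_add_le (z - b) (b - a)
    linarith
  · intro h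
    refine h.move fun z hz => ?_
    rw [norm_sub_rev]
    linarith [hd z hz]

lemma no_root_zero {C : Set ℂ} (hC : IsPreconnected C) (hne : C.Nonempty)
    (hs : ∀ z ∈ C, -z ∈ C) (h0 : (0:ℂ) ∉ C) : ¬ HasRoot C 0 := by
  rintro ⟨s, hcs, hsq⟩
  simp only [sub_zero] at hsq
  have hsne : ∀ z ∈ C, s z ≠ 0 := fun z hz h => by
    have := hsq z hz; rw [h] at this; apply h0
    have : z = 0 := by rw [← this]; norm_num
    exact this ▸ hz
  have hcn : ContinuousOn (fun z => s (-z)) C :=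
    hcs.comp continuousOn_neg (fun z hz => hs z hz)
  have := hC.eq_or_eq_neg_of_sq_eq hcn (continuousOn_const.mul hcs : ContinuousOn (fun z => Complex.I * s z) C)
    (fun z hz => by
      simp only [Pi.pow_apply, Pi.mul_apply]
      rw [hsq _ (hs z hz), mul_pow, Complex.I_sq, hsq z hz]; ring)
    (fun {z} hz => mul_ne_zero Complex.I_ne_zero (hsne z hz))
  obtain ⟨z, hz⟩ := hne
  rcases this with h | h
  · have h1 := h hz
    have h2 := h (hs z hz)
    simp only [neg_neg, Pi.mul_apply] at h1 h2
    rw [h1, ← mul_assoc, Complex.I_mul_I] at h2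
    apply hsne z hz; linear_combination h2 / 2
  · have h1 := h hz
    have h2 := h (hs z hz)
    simp only [neg_neg, Pi.neg_apply, Pi.mul_apply] at h1 h2
    rw [h1, mul_neg, neg_neg, ← mul_assoc, Complex.I_mul_I] at h2
    apply hsne z hz; linear_combination h2 / 2

lemma zero_mem_complex (O : Set ℂ) (ho : IsOpen O) (hc : IsConnected O)
    (hb : Bornology.IsBounded O) (hs : ∀ z ∈ O, -z ∈ O) (hf : IsPreconnected (frontier O)) :
    (0:ℂ) ∈ O := by
  by_contra h0
  obtain ⟨p, hp⟩ := hc.nonempty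
  have hpc := (ho.isConnected_iff_isPathConnected.1 hc)
  obtain ⟨g, hg⟩ := hpc.joinedIn p hp (-p) (hs p hp)
  set C : Set ℂ := Set.range g ∪ (fun z => -z) '' Set.range g with hCdef
  have hrc : IsPreconnected (Set.range g) := isPreconnected_range g.continuous
  have hCc : IsCompact C := (isCompact_range g.continuous).union
    ((isCompact_range g.continuous).image continuous_neg)
  have hpr : p ∈ Set.range g := ⟨0, g.source⟩
  have hpr' : -p ∈ Set.range g := ⟨1, g.target⟩
  have hCp : IsPreconnected C := by
    refine IsPreconnected.union p hpr ⟨-p, hpr', by simp⟩ hrc (hrc.image _ continuous_neg.continuousOn)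
  have hCO : C ⊆ O := by
    rintro z (⟨t, rfl⟩ | ⟨_, ⟨t, rfl⟩, rfl⟩)
    · exact hg t
    · exact hs _ (hg t)
  have hCs : ∀ z ∈ C, -z ∈ C := by
    rintro z (h | ⟨y, h, rfl⟩)
    · exact Or.inr ⟨z, h, rfl⟩
    · left; simpa using h
  refine no_root_zero hCp ⟨p, Or.inl hpr⟩ hCs (fun h => h0 (hCO h)) ?_
  have hnh : ∀ a ∉ O, ∀ᶠ b in nhds a, (HasRoot C b ↔ HasRoot C a) := fun a ha =>
    hasRoot_nhds hCc.isClosed (fun h => ha (hCO h))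
  -- general clopen argument
  have key : ∀ P : ℂ → Prop, (∀ a ∉ O, ∀ᶠ b in nhds a, (P b ↔ P a)) →
      (∀ a ∈ frontier O, P a) → ∀ a ∉ O, P a := by
    intro P hP hF
    have hcl : IsClopen {a | a ∈ O ∨ P a} := by
      constructor
      · rw [← isOpen_compl_iff, isOpen_iff_mem_nhds]
        intro a ha
        simp only [Set.mem_compl_iff, Set.mem_ofPred_eq, not_or] at ha
        have hacl : a ∉ closure O := fun h => ha.2 (hF a (by
          rw [ho.frontier_eq]; exact ⟨h, ha.1⟩))
        filter_upwards [hP a ha.1, isClosed_closure.isOpen_compl.mem_nhds hacl] with b hb hb2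
        simp only [Set.mem_compl_iff, Set.mem_ofPred_eq, not_or]
        exact ⟨fun h => hb2 (subset_closure h), fun h => ha.2 (hb.1 h)⟩
      · rw [isOpen_iff_mem_nhds]
        intro a ha
        by_cases hO : a ∈ O
        · filter_upwards [ho.mem_nhds hO] with b hb using Or.inl hb
        · filter_upwards [hP a hO] with b hb using Or.inr (hb.2 (ha.resolve_left hO))
    have := hcl.eq_univ ⟨p, Or.inl hp⟩
    intro a ha
    have h : a ∈ {a | a ∈ O ∨ P a} := this ▸ Set.mem_univ a
    exact h.resolve_left ha
  have hfO : ∀ a ∈ frontier O, a ∉ O := fun a ha => by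
    rw [ho.frontier_eq] at ha; exact ha.2
  -- constancy on the frontier
  have hfc : (∀ a ∈ frontier O, HasRoot C a) ∨ (∀ a ∈ frontier O, ¬ HasRoot C a) := by
    by_contra! hcon
    obtain ⟨⟨a, ha, hna⟩, ⟨b, hb', hrb⟩⟩ := hcon
    have hU : IsOpen (interior {a | HasRoot C a}) := isOpen_interior
    have hV : IsOpen (interior {a | ¬ HasRoot C a}) := isOpen_interior
    have h1 : ∀ x ∈ frontier O, HasRoot C x → x ∈ interior {a | HasRoot C a} := by
      intro x hx h
      rw [mem_interior_iff_mem_nhds]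
      filter_upwards [hnh x (hfO x hx)] with y hy using hy.2 h
    have h2 : ∀ x ∈ frontier O, ¬ HasRoot C x → x ∈ interior {a | ¬ HasRoot C a} := by
      intro x hx h
      rw [mem_interior_iff_mem_nhds]
      filter_upwards [hnh x (hfO x hx)] with y hy using fun h' => h (hy.1 h')
    obtain ⟨x, hx, hx1, hx2⟩ := hf _ _ hU hV (fun x hx => by
      by_cases h : HasRoot C x
      · exact Or.inl (h1 x hx h)
      · exact Or.inr (h2 x hx h)) ⟨b, hb', h1 b hb' hrb⟩ ⟨a, ha, h2 a ha hna⟩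
    have hy1 : x ∈ {a | HasRoot C a} := interior_subset hx1
    have hy2 : x ∈ {a | ¬ HasRoot C a} := interior_subset hx2
    exact hy2 hy1
  rcases hfc with h | h
  · exact key _ hnh h 0 h0
  · exfalso
    have hk := key (fun a => ¬ HasRoot C a) (fun a ha => (hnh a ha).mono fun b hb => not_congr hb) h
    obtain ⟨R, hR⟩ := hb.exists_norm_le
    have hRp := hR p hp
    have hR0 : 0 ≤ R := (norm_nonneg _).trans hRp
    have hn : ‖((R + 1 : ℝ) : ℂ)‖ = R + 1 := by
      rw [Complex.norm_real, Real.norm_of_nonneg (by linarith)]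
    refine hk ((R + 1 : ℝ) : ℂ) (fun hmem => ?_) (hasRoot_far fun z hz => ?_)
    · have := hR _ hmem; rw [hn] at this; linarith
    · rw [hn]; have := hR _ (hCO hz); linarith

lemma zero_mem_prod (O : Set (ℝ × ℝ)) (ho : IsOpen O) (hc : IsConnected O)
    (hb : Bornology.IsBounded O) (hs : ∀ z ∈ O, -z ∈ O) (hf : IsPreconnected (frontier O)) :
    (0:ℝ × ℝ) ∈ O := by
  let e : ℂ ≃L[ℝ] ℝ × ℝ := Complex.equivRealProdCLM
  have himg : e ⁻¹' O = e.symm '' O := by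
    rw [ContinuousLinearEquiv.image_symm_eq_preimage]
  have := zero_mem_complex (e ⁻¹' O) (ho.preimage e.continuous)
    (by rw [himg]; exact hc.image _ e.symm.continuous.continuousOn)
    (by rw [himg]
        exact (e.symm : (ℝ × ℝ) →L[ℝ] ℂ).lipschitz.isBounded_image hb)
    (fun z hz => by
      simp only [Set.mem_preimage, map_neg] at hz ⊢; exact hs _ hz)
    (by
      have := e.toHomeomorph.preimage_frontier O
      have h2 : e ⁻¹' (frontier O) = frontier (e ⁻¹' O) := this
      rw [← h2, ← ContinuousLinearEquiv.image_symm_eq_preimage]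
      exact hf.image _ e.symm.continuous.continuousOn)
  simpa using this

lemma null_range (γ : ℝ → ℝ × ℝ) (h : ContDiff ℝ 1 γ) : volume (Set.range γ) = 0 := by
  have h1 : dimH (Set.range γ) < (2 : NNReal) := by
    refine h.dimH_range_le.trans_lt ?_
    simp
  refine measure_zero_of_dimH_lt (d := 2) ?_ h1
  have := hausdorffMeasure_prod_real
  simp only [NNReal.coe_ofNat]
  rw [this]

lemma ind_lip {Om : Set (ℝ × ℝ)} (ho : IsOpen Om) {h : ℝ × ℝ → ℝ} {C : NNReal}
    (hl : LipschitzWith C h) (hz : ∀ p ∈ frontier Om, h p = 0) :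
    LipschitzWith C (Om.indicator h) := by
  have main : ∀ x ∈ Om, ∀ y ∉ Om, dist (h x) 0 ≤ C * dist x y := by
    intro x hx y hy
    have : ∃ z ∈ segment ℝ x y, z ∈ frontier Om := by
      by_contra! hcon
      have hcov : segment ℝ x y ⊆ Om ∪ (closure Om)ᶜ := by
        intro z hzs
        by_cases h1 : z ∈ Om
        · exact Or.inl h1
        · refine Or.inr fun h2 => hcon z hzs ?_
          rw [ho.frontier_eq]; exact ⟨h2, h1⟩
      have hyc : y ∈ (closure Om)ᶜ := (hcov (right_mem_segment ℝ x y)).resolve_left hy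
      obtain ⟨z, _, h1, h2⟩ := (convex_segment (𝕜 := ℝ) x y).isPreconnected _ _ ho
        isClosed_closure.isOpen_compl hcov
        ⟨x, left_mem_segment ℝ x y, hx⟩ ⟨y, right_mem_segment ℝ x y, hyc⟩
      exact h2 (subset_closure h1)
    obtain ⟨z, hzs, hzf⟩ := this
    have h1 := hl.dist_le_mul x z
    rw [hz z hzf] at h1
    refine h1.trans (mul_le_mul_of_nonneg_left ?_ C.2)
    have := dist_add_dist_of_mem_segment hzs
    linarith [dist_nonneg (x := z) (y := y)]
  refine LipschitzWith.of_dist_le_mul fun x y => ?_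
  by_cases hx : x ∈ Om <;> by_cases hy : y ∈ Om
  · simpa [hx, hy] using hl.dist_le_mul x y
  · simpa [hx, hy] using main x hx y hy
  · have := main y hy x hx
    rw [dist_comm, dist_comm y x] at this
    simpa [hx, hy] using this
  · simp [hx, hy]; positivity

lemma ibp {Om : Set (ℝ × ℝ)} (ho : IsOpen Om) (hnull : volume (frontier Om) = 0)
    {h : ℝ × ℝ → ℝ} (hh : ContDiff ℝ 1 h) (hcs : HasCompactSupport h)
    (hz : ∀ p ∈ frontier Om, h p = 0) (k : ℝ × ℝ →L[ℝ] ℝ) (φ : ℝ) (e : ℝ × ℝ) :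
    ∫ p, Om.indicator (fun p => fderiv ℝ h p e) p * cos (k p + φ)
      = -(k e) * ∫ p, Om.indicator h p * cos (k p + φ + π / 2) := by
  obtain ⟨C, hC⟩ := hh.lipschitzWith_of_hasCompactSupport hcs (by simp)
  have hl := ind_lip ho hC hz
  have hf : LipschitzWith (1 * (‖k‖₊ + 0)) (fun p => cos (k p + φ)) :=
    Real.lipschitzWith_cos.comp (k.lipschitz.add (LipschitzWith.const φ))
  have hics : HasCompactSupport (Om.indicator h) :=
    hcs.mono (by
      intro p hp
      simp only [Function.mem_support, ne_eq, Set.indicator_apply_eq_zero, not_forall] at hp ⊢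
      exact hp.2)
  have key := LipschitzWith.integral_lineDeriv_mul_eq (μ := volume) hf hl hics (-e)
  rw [neg_neg] at key
  have h1 : ∀ p, lineDeriv ℝ (fun p => cos (k p + φ)) p (-e) = -(k e) * cos (k p + φ + π / 2) := by
    intro p
    have : HasFDerivAt (fun p => cos (k p + φ)) (-sin (k p + φ) • k) p :=
      ((k.hasFDerivAt (x := p)).add_const φ).cos
    rw [this.hasLineDerivAt (-e) |>.lineDeriv, cos_add_pi_div_two]
    simp
    ring
  have h2 : ∀ᵐ p, lineDeriv ℝ (Om.indicator h) p e = Om.indicator (fun p => fderiv ℝ h p e) p := by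
    have : ∀ᵐ p, p ∉ frontier Om := measure_eq_zero_iff_ae_notMem.1 hnull
    filter_upwards [this] with p hp
    by_cases hpO : p ∈ Om
    · have : Om.indicator h =ᶠ[nhds p] h := by
        filter_upwards [ho.mem_nhds hpO] with q hq using Set.indicator_of_mem hq h
      rw [this.lineDeriv_eq, Set.indicator_of_mem hpO,
        ((hh.differentiable (by simp)) p).lineDeriv_eq_fderiv]
    · have hcl : p ∉ closure Om := fun hc => hp (by rw [ho.frontier_eq]; exact ⟨hc, hpO⟩)
      have : Om.indicator h =ᶠ[nhds p] fun _ => 0 := by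
        filter_upwards [isClosed_closure.isOpen_compl.mem_nhds hcl] with q hq
        exact Set.indicator_of_notMem (fun hh => hq (subset_closure hh)) h
      rw [this.lineDeriv_eq, Set.indicator_of_notMem hpO]
      simp [lineDeriv]
  have e1 : ∫ p, Om.indicator (fun p => fderiv ℝ h p e) p * cos (k p + φ)
      = ∫ p, lineDeriv ℝ (Om.indicator h) p e * cos (k p + φ) := by
    refine integral_congr_ae ?_
    filter_upwards [h2] with p hp
    rw [hp]
  rw [e1, ← key, ← integral_const_mul]
  refine integral_congr_ae (Filter.Eventually.of_forall fun p => ?_)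
  simp only [h1]; ring

lemma ind_cont {Om : Set (ℝ × ℝ)} (ho : IsOpen Om) 
    {h : ℝ × ℝ → ℝ} (hh : ContDiff ℝ 1 h) (hcs : HasCompactSupport h)
    (hz : ∀ p ∈ frontier Om, h p = 0) :
    Continuous (Om.indicator h) ∧ HasCompactSupport (Om.indicator h) := by
  obtain ⟨C, hC⟩ := hh.lipschitzWith_of_hasCompactSupport hcs (by simp)
  refine ⟨(ind_lip ho hC hz).continuous, hcs.mono ?_⟩
  intro p hp
  simp only [Function.mem_support, ne_eq, Set.indicator_apply_eq_zero, not_forall] at hp ⊢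
  exact hp.2

lemma integ_cos {f : ℝ × ℝ → ℝ} (hf : Integrable f) (k : ℝ × ℝ →L[ℝ] ℝ) (φ : ℝ) :
    Integrable (fun p => f p * cos (k p + φ)) := by
  refine hf.mul_bdd (c := 1) (by
    have : Continuous fun p => cos (k p + φ) := by fun_prop
    exact this.aestronglyMeasurable) (Filter.Eventually.of_forall fun p => ?_)
  simpa using abs_cos_le_one _

lemma fourier_vanish {Om : Set (ℝ × ℝ)} (ho : IsOpen Om) (hnull : volume (frontier Om) = 0)
    {g : ℝ × ℝ → ℝ} (hg : ContDiff ℝ 2 g) (hcs : HasCompactSupport g)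
    (hz : ∀ p ∈ frontier Om, g p = 0) (hz' : ∀ p ∈ frontier Om, fderiv ℝ g p = 0) (μ : ℝ)
    (hpde : ∀ p ∈ Om, fderiv ℝ (fun q => fderiv ℝ g q (1,0)) p (1,0)
      + fderiv ℝ (fun q => fderiv ℝ g q (0,1)) p (0,1) = -(μ * g p))
    (k : ℝ × ℝ →L[ℝ] ℝ) (φ : ℝ) (hk : k (1,0) ^ 2 + k (0,1) ^ 2 ≠ μ) :
    ∫ p, Om.indicator g p * cos (k p + φ) = 0 := by
  have hd : ∀ e : ℝ × ℝ, ContDiff ℝ 1 (fun q => fderiv ℝ g q e) := fun e =>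
    (hg.fderiv_right (m := 1) (by norm_num)).clm_apply contDiff_const
  have hdc : ∀ e : ℝ × ℝ, HasCompactSupport (fun q => fderiv ℝ g q e) := fun e =>
    hcs.fderiv_apply ℝ e
  have step : ∀ e : ℝ × ℝ,
      ∫ p, Om.indicator (fun p => fderiv ℝ (fun q => fderiv ℝ g q e) p e) p * cos (k p + φ)
        = -(k e)^2 * ∫ p, Om.indicator g p * cos (k p + φ) := by
    intro e
    rw [ibp ho hnull (hd e) (hdc e) (fun p hp => by simp [hz' p hp]) k φ e]
    have := ibp ho hnull (hg.of_le (by norm_num)) hcs hz k (φ + π / 2) e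
    simp only [← add_assoc] at this
    rw [this]
    have h3 : ∀ p, cos (k p + φ + π / 2 + π / 2) = - cos (k p + φ) := by
      intro p; rw [add_assoc, add_halves, cos_add_pi]
    simp only [h3, mul_neg, integral_neg]
    ring
  have hintg : ∀ e : ℝ × ℝ, Integrable
      (fun p => Om.indicator (fun p => fderiv ℝ (fun q => fderiv ℝ g q e) p e) p * cos (k p + φ)) := by
    intro e
    apply integ_cos
    refine Integrable.indicator ?_ ho.measurableSet
    exact (((hd e).continuous_fderiv (by simp)).clm_apply continuous_const).integrable_of_hasCompactSupport
      ((hdc e).fderiv_apply ℝ e)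
  have hsum := integral_add (hintg (1,0)) (hintg (0,1))
  rw [step, step] at hsum
  have hl : ∫ p, (Om.indicator (fun p => fderiv ℝ (fun q => fderiv ℝ g q (1,0)) p (1,0)) p * cos (k p + φ)
      + Om.indicator (fun p => fderiv ℝ (fun q => fderiv ℝ g q (0,1)) p (0,1)) p * cos (k p + φ))
      = -μ * ∫ p, Om.indicator g p * cos (k p + φ) := by
    rw [← integral_const_mul]
    refine integral_congr_ae (Filter.Eventually.of_forall fun p => ?_)
    by_cases hp : p ∈ Om
    · simp only [Set.indicator_of_mem hp]
      rw [← add_mul, hpde p hp]; ring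
    · simp [hp]
  rw [hl] at hsum
  have : (k (1,0) ^ 2 + k (0,1) ^ 2 - μ) * ∫ p, Om.indicator g p * cos (k p + φ) = 0 := by
    linear_combination hsum
  exact (mul_eq_zero.1 this).resolve_left (sub_ne_zero.2 hk)

open FourierTransform in
lemma zero_of_fourier {v : ℝ × ℝ → ℝ} (hv : Continuous v) (hvc : HasCompactSupport v) (μ : ℝ)
    (H : ∀ (k : ℝ × ℝ →L[ℝ] ℝ) (φ : ℝ), k (1,0) ^ 2 + k (0,1) ^ 2 ≠ μ →
      ∫ p, v p * cos (k p + φ) = 0) (p : ℝ × ℝ) : v p = 0 := by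
  let V : ℂ → ℂ := fun z => (v (z.re, z.im) : ℂ)
  have hVc : Continuous V := by
    have : Continuous fun z : ℂ => (z.re, z.im) := Complex.continuous_re.prodMk Complex.continuous_im
    exact Complex.continuous_ofReal.comp (hv.comp this)
  have mp := Complex.volume_preserving_equiv_real_prod
  have hvi : Integrable v := hv.integrable_of_hasCompactSupport hvc
  have hVi : Integrable V := 
    ((mp.integrable_comp_emb Complex.measurableEquivRealProd.measurableEmbedding).2 hvi).ofReal
  have hF : ∀ w : ℂ, (2 * π) ^ 2 * ‖w‖ ^ 2 ≠ μ → 𝓕 V w = 0 := by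
    intro w hw
    let k : ℝ × ℝ →L[ℝ] ℝ := (-2 * π * w.re) • ContinuousLinearMap.fst ℝ ℝ ℝ
      + (-2 * π * w.im) • ContinuousLinearMap.snd ℝ ℝ ℝ
    have hk : k (1,0) ^ 2 + k (0,1) ^ 2 ≠ μ := by
      intro h; apply hw; rw [← h, ← Complex.normSq_eq_norm_sq, Complex.normSq_apply]
      simp [k]; ring
    rw [Real.fourier_eq']
    have e1 : (∫ z : ℂ, Complex.exp ((↑(-2 * π * inner ℝ z w) * Complex.I)) • V z)
        = ∫ p : ℝ × ℝ, (((v p * cos (k p + 0) : ℝ) : ℂ) + ((v p * cos (k p + (-(π/2))) : ℝ) : ℂ) * Complex.I) := by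
      rw [← mp.integral_comp Complex.measurableEquivRealProd.measurableEmbedding]
      refine integral_congr_ae (Filter.Eventually.of_forall fun z => ?_)
      have hin : -2 * π * inner ℝ z w = k (z.re, z.im) := by
        simp [k, Complex.inner]; ring
      simp only [hin, Complex.measurableEquivRealProd_apply, V, smul_eq_mul]
      rw [Complex.exp_mul_I, ← Complex.ofReal_cos, ← Complex.ofReal_sin, add_zero,
        ← sub_eq_add_neg, Real.cos_sub_pi_div_two]
      push_cast; ring
    rw [e1, integral_add (integ_cos hvi k 0).ofReal ((integ_cos hvi k _).ofReal.mul_const _),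
      integral_mul_const, integral_complex_ofReal, integral_complex_ofReal, H k _ hk, H k _ hk]
    simp
  have hF0 : 𝓕 V =ᵐ[volume] (fun _ => 0) := by
    have hs : volume (Metric.sphere (0:ℂ) (√ (μ / (2 * π)^2))) = 0 := 
      Measure.addHaar_sphere volume _ _
    filter_upwards [measure_eq_zero_iff_ae_notMem.1 hs] with w hw
    apply hF
    intro h
    apply hw
    rw [mem_sphere_zero_iff_norm, ← h, mul_div_cancel_left₀ _ (by positivity), Real.sqrt_sq (norm_nonneg _)]
  have hFi : Integrable (𝓕 V) := (integrable_zero ℂ ℂ volume).congr hF0.symm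
  have hinv := congrFun (hVc.fourierInv_fourier_eq hVi hFi) (p.1 + p.2 * Complex.I)
  rw [Real.fourierInv_congr_ae hF0, Real.fourierInv_eq] at hinv
  simpa [V] using hinv.symm

lemma fderiv_neg_arg (f : ℝ × ℝ → ℝ) (p : ℝ × ℝ) (hf : DifferentiableAt ℝ f (-p)) :
    fderiv ℝ (fun q => f (-q)) p = - fderiv ℝ f (-p) := by
  have h1 : HasFDerivAt (fun q : ℝ × ℝ => -q) (-(ContinuousLinearMap.id ℝ (ℝ × ℝ))) p :=
    (hasFDerivAt_id p).neg
  have h2 := HasFDerivAt.comp (g := f) (f := fun q : ℝ × ℝ => -q) p hf.hasFDerivAt h1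
  have h3 := h2.fderiv
  have h4 : fderiv ℝ (fun q => f (-q)) p =
    (fderiv ℝ f (-p)).comp (-(ContinuousLinearMap.id ℝ (ℝ × ℝ))) := h3
  rw [h4]
  ext <;> simp


open scoped Manifold ContDiff in
lemma cutoff {K U : Set (ℝ × ℝ)} (hK : IsCompact K) (hU : IsOpen U) (hKU : K ⊆ U)
    {u : ℝ × ℝ → ℝ} (hu : ContDiffOn ℝ (⊤ : ℕ∞) u U) :
    ∃ g : ℝ × ℝ → ℝ, ContDiff ℝ (⊤ : ℕ∞) g ∧ HasCompactSupport g ∧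
      ∀ p ∈ K, g =ᶠ[nhds p] u := by
  obtain ⟨t, ht, hKt, htU⟩ := exists_compact_between hK hU hKU
  obtain ⟨f, hf1, hf0, -⟩ := exists_contMDiffMap_one_nhds_of_subset_interior (n := (⊤ : ℕ∞))
    (𝓘(ℝ, ℝ × ℝ)) hK.isClosed hKt
  have hfs : ContDiff ℝ (⊤ : ℕ∞) f := f.contMDiff.contDiff
  refine ⟨fun p => f p * u p, ?_, ?_, ?_⟩
  · rw [contDiff_iff_contDiffAt]
    intro x
    by_cases hx : x ∈ t
    · exact hfs.contDiffAt.mul (hu.contDiffAt (hU.mem_nhds (htU hx)))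
    · have : (fun p => f p * u p) =ᶠ[nhds x] fun _ => 0 := by
        filter_upwards [ht.isClosed.isOpen_compl.mem_nhds hx] with y hy
        rw [hf0 y hy, zero_mul]
      exact contDiffAt_const.congr_of_eventuallyEq this
  · refine HasCompactSupport.intro ht fun x hx => ?_
    rw [hf0 x hx, zero_mul]
  · intro p hp
    have := (eventually_nhdsSet_iff_forall.1 hf1) p hp
    filter_upwards [this] with q hq
    rw [hq, one_mul]

/-- If `Ω` is centrally symmetric, then `ω` is even, `Rω` is
even, and the origin is a zero of both `Rω` and its gradient. -/
theorem solution_is_even_and_origin_is_node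
    (Om : Set (ℝ × ℝ)) (hopen : IsOpen Om) (hconn : IsConnected Om)
    (hbdd : Bornology.IsBounded Om)
    (hsymm : ∀ p ∈ Om, -p ∈ Om)
    (L : ℝ) (hL : 0 < L)
    (γ : ℝ → ℝ × ℝ) (θ : ℝ → ℝ)
    (hγsmooth : ContDiff ℝ (⊤ : ℕ∞) γ) (hθsmooth : ContDiff ℝ (⊤ : ℕ∞) θ)
    (hγper : ∀ s, γ (s + L) = γ s)
    (hθper : ∀ s, θ (s + L) = θ s + 2 * π)
    (hrange : Set.range γ = frontier Om)
    (hinj : Set.InjOn γ (Set.Ico 0 L))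
    (hγderiv : ∀ s, deriv γ s = (Real.cos (θ s), Real.sin (θ s)))
    (ω : ℝ × ℝ → ℝ) (μ : ℝ) (c : ℝ) (hμpos : 0 < μ) (hc : c ≠ 0)
    (hωsmooth : SmoothNearClosure Om ω)
    (hωpde : ∀ p ∈ Om, - lap ω p = μ * ω p)
    (hωNeumann : ∀ s, nderiv (θ s) ω (γ s) = 0)
    (hωbdry : ∀ p ∈ frontier Om, ω p = c)
 :
    (∀ p ∈ Om, ω (-p) = ω p)
    ∧ (∀ p ∈ Om, Rop ω (-p) = Rop ω p)
    ∧ Rop ω (0 : ℝ × ℝ) = 0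
    ∧ pdx (Rop ω) (0 : ℝ × ℝ) = 0 ∧ pdy (Rop ω) (0 : ℝ × ℝ) = 0 := by
  obtain ⟨U, hU, hclU, hω⟩ := hωsmooth
  have hfp : IsPreconnected (frontier Om) := by
    rw [← hrange]; exact isPreconnected_range hγsmooth.continuous
  have h0 : (0 : ℝ × ℝ) ∈ Om := zero_mem_prod Om hopen hconn hbdd hsymm hfp
  have hnull : volume (frontier Om) = 0 := by
    rw [← hrange]; exact null_range γ (hγsmooth.of_le (by exact_mod_cast le_top))
  -- the gradient vanishes on the boundary
  have hdiffU : ∀ p ∈ U, ContDiffAt ℝ (⊤ : ℕ∞) ω p := fun p hp => hω.contDiffAt (hU.mem_nhds hp)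
  have hOmU : Om ⊆ U := subset_closure.trans hclU
  have hd1 : ∀ p ∈ U, DifferentiableAt ℝ ω p := fun p hp =>
    (hdiffU p hp).differentiableAt (by simp)
  have hd2 : ∀ e : ℝ × ℝ, ∀ p ∈ U, DifferentiableAt ℝ (fun q => fderiv ℝ ω q e) p := by
    intro e p hp
    have : ContDiffAt ℝ 1 (fderiv ℝ ω) p :=
      (hdiffU p hp).fderiv_right (m := 1) (by norm_cast)
    exact (this.differentiableAt (by simp)).clm_apply (differentiableAt_const e)
  have hgrad : ∀ p ∈ frontier Om, fderiv ℝ ω p = 0 := by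
    intro p hp
    have hp' := hp
    rw [← hrange] at hp
    obtain ⟨s, rfl⟩ := hp
    have hγd : HasDerivAt γ (cos (θ s), sin (θ s)) s := by
      rw [← hγderiv s]
      exact ((hγsmooth.differentiable (by simp)) s).hasDerivAt
    have h1 : HasDerivAt (fun t => ω (γ t)) (fderiv ℝ ω (γ s) (cos (θ s), sin (θ s))) s :=
      (hd1 _ (hclU (frontier_subset_closure hp'))).hasFDerivAt.comp_hasDerivAt s hγd
    have h2 : (fun t => ω (γ t)) = fun _ => c := by
      funext t; exact hωbdry _ (hrange ▸ ⟨t, rfl⟩)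
    rw [h2] at h1
    have h3 := h1.unique (hasDerivAt_const s c)
    have h4 := hωNeumann s
    have hdec : ∀ a b : ℝ, fderiv ℝ ω (γ s) (a, b) = a * pdx ω (γ s) + b * pdy ω (γ s) := by
      intro a b
      have : ((a, b) : ℝ × ℝ) = a • ((1:ℝ), (0:ℝ)) + b • ((0:ℝ), (1:ℝ)) := by simp
      rw [this, map_add, map_smul, map_smul]; rfl
    rw [hdec] at h3
    unfold nderiv at h4
    have hsc := sin_sq_add_cos_sq (θ s)
    have hx : pdx ω (γ s) = 0 := by
      linear_combination cos (θ s) * h3 + sin (θ s) * h4 - pdx ω (γ s) * hsc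
    have hy : pdy ω (γ s) = 0 := by
      linear_combination sin (θ s) * h3 - cos (θ s) * h4 - pdy ω (γ s) * hsc
    ext <;> simp [hdec, hx, hy]
  -- symmetry of closure and frontier
  have hnegeq : Neg.neg ⁻¹' Om = Om := by
    ext p; constructor
    · intro hp; simpa using hsymm _ hp
    · intro hp; exact hsymm p hp
  have hfneg : ∀ p ∈ frontier Om, -p ∈ frontier Om := by
    intro p hp
    have := (Homeomorph.neg (ℝ × ℝ)).preimage_frontier Om
    have h2 : Neg.neg ⁻¹' (frontier Om) = frontier (Neg.neg ⁻¹' Om) := this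
    rw [hnegeq] at h2
    rw [← h2] at hp; exact hp
  have hcneg : ∀ p ∈ closure Om, -p ∈ closure Om := by
    intro p hp
    have := (Homeomorph.neg (ℝ × ℝ)).preimage_closure Om
    have h2 : Neg.neg ⁻¹' (closure Om) = closure (Neg.neg ⁻¹' Om) := this
    rw [hnegeq] at h2
    rw [← h2] at hp; exact hp
  -- odd part, cut off
  have hKc : IsCompact (closure Om) := hbdd.isCompact_closure
  have hu : ContDiffOn ℝ (⊤ : ℕ∞) (fun p => ω p - ω (-p)) (U ∩ Neg.neg ⁻¹' U) :=
    (hω.mono Set.inter_subset_left).sub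
      (hω.comp contDiff_neg.contDiffOn (fun p hp => hp.2))
  obtain ⟨g, hg, hgc, hgu⟩ := cutoff hKc (hU.inter (hU.preimage continuous_neg))
    (fun p hp => ⟨hclU hp, hclU (hcneg p hp)⟩) hu
  have hdn : ∀ f : ℝ × ℝ → ℝ, ∀ p, DifferentiableAt ℝ f (-p) →
      DifferentiableAt ℝ (fun q => f (-q)) p := fun f p hf =>
    DifferentiableAt.comp (g := f) (f := fun q : ℝ × ℝ => -q) p hf differentiableAt_id.neg
  have hgz : ∀ p ∈ frontier Om, g p = 0 := by
    intro p hp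
    rw [(hgu p (frontier_subset_closure hp)).eq_of_nhds, hωbdry p hp, hωbdry _ (hfneg p hp), sub_self]
  have hgd : ∀ p ∈ closure Om, fderiv ℝ g p = fderiv ℝ ω p + fderiv ℝ ω (-p) := by
    intro p hp
    rw [(hgu p hp).fderiv_eq, fderiv_fun_sub (hd1 p (hclU hp))
      (hdn _ _ (hd1 _ (hclU (hcneg p hp)))),
      fderiv_neg_arg _ _ (hd1 _ (hclU (hcneg p hp))), sub_neg_eq_add]
  have hgz' : ∀ p ∈ frontier Om, fderiv ℝ g p = 0 := by
    intro p hp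
    rw [hgd p (frontier_subset_closure hp), hgrad p hp, hgrad _ (hfneg p hp), add_zero]
  have hgdd : ∀ e : ℝ × ℝ, ∀ p ∈ Om, fderiv ℝ (fun q => fderiv ℝ g q e) p e =
      fderiv ℝ (fun q => fderiv ℝ ω q e) p e - fderiv ℝ (fun q => fderiv ℝ ω q e) (-p) e := by
    intro e p hp
    have h1 : (fun q => fderiv ℝ g q e) =ᶠ[nhds p]
        fun q => fderiv ℝ ω q e + fderiv ℝ ω (-q) e := by
      filter_upwards [hopen.mem_nhds hp] with q hq
      rw [hgd q (subset_closure hq)]; rfl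
    rw [h1.fderiv_eq, fderiv_fun_add (hd2 e p (hOmU hp))
      (hdn _ _ (hd2 e _ (hOmU (hsymm p hp)))), 
      fderiv_neg_arg (fun q => fderiv ℝ ω q e) _ (hd2 e _ (hOmU (hsymm p hp)))]
    simp [sub_eq_add_neg]
  have hgpde : ∀ p ∈ Om, fderiv ℝ (fun q => fderiv ℝ g q (1,0)) p (1,0)
      + fderiv ℝ (fun q => fderiv ℝ g q (0,1)) p (0,1) = -(μ * g p) := by
    intro p hp
    rw [hgdd _ p hp, hgdd _ p hp, (hgu p (subset_closure hp)).eq_of_nhds]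
    have h1 := hωpde p hp
    have h2 := hωpde _ (hsymm p hp)
    have hl : ∀ q, lap ω q = fderiv ℝ (fun q => fderiv ℝ ω q (1,0)) q (1,0)
      + fderiv ℝ (fun q => fderiv ℝ ω q (0,1)) q (0,1) := fun q => rfl
    rw [hl] at h1 h2
    linear_combination h2 - h1
  have hg2 : ContDiff ℝ 2 g := contDiff_infty.1 hg 2
  have hg1 : ContDiff ℝ 1 g := hg.of_le (by exact_mod_cast le_top)
  obtain ⟨hvc, hvcs⟩ := ind_cont hopen hg1 hgc hgz
  have heven : ∀ p ∈ Om, ω (-p) = ω p := by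
    intro p hp
    have := zero_of_fourier hvc hvcs μ
      (fun k φ hk => fourier_vanish hopen hnull hg2 hgc hgz hgz' μ hgpde k φ hk) p
    rw [Set.indicator_of_mem hp, (hgu p (subset_closure hp)).eq_of_nhds] at this
    linarith
  have hgo : ∀ p ∈ Om, fderiv ℝ ω (-p) = - fderiv ℝ ω p := by
    intro p hp
    have h1 : (fun q => ω (-q)) =ᶠ[nhds p] ω := by
      filter_upwards [hopen.mem_nhds hp] with q hq using heven q hq
    rw [← h1.fderiv_eq, fderiv_neg_arg _ _ (hd1 _ (hOmU (hsymm p hp))), neg_neg]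
  have hg0 : fderiv ℝ ω 0 = 0 := by
    have := hgo 0 h0
    rw [neg_zero] at this
    ext
    · have h := DFunLike.congr_fun this (1, 0)
      simp only [ContinuousLinearMap.neg_apply] at h
      simp; linarith
    · have h := DFunLike.congr_fun this (0, 1)
      simp only [ContinuousLinearMap.neg_apply] at h
      simp; linarith
  have hR : HasFDerivAt (Rop ω) (0 : ℝ × ℝ →L[ℝ] ℝ) 0 := by
    have hx : HasFDerivAt (pdx ω) _ 0 := (hd2 (1,0) 0 (hOmU h0)).hasFDerivAt
    have hy : HasFDerivAt (pdy ω) _ 0 := (hd2 (0,1) 0 (hOmU h0)).hasFDerivAt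
    have := ((hasFDerivAt_snd (𝕜 := ℝ) (p := (0 : ℝ × ℝ))).neg.mul hx).add
      ((hasFDerivAt_fst (𝕜 := ℝ) (p := (0 : ℝ × ℝ))).mul hy)
    refine this.congr_fderiv ?_
    ext <;> simp [pdx, pdy, hg0]
  refine ⟨heven, ?_, ?_, ?_, ?_⟩
  · intro p hp
    unfold Rop pdx pdy
    rw [hgo p hp]
    simp
  · simp [Rop]
  · unfold pdx; rw [hR.fderiv]; rfl
  · unfold pdy; rw [hR.fderiv]; rfl
end
end
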